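/- arXiv:2508.14287 — 3 statements merged into one kernel-verified Lean document; each statement's English description precedes it below -/
import Mathlib

section
/- There exist absolute constants C, C₀ > 0 such that for every integer n ≥ 2 and every real ε with C₀·log₂ n / n ≤ ε ≤ 1, there is a deterministic online sorting algorithm with known range that uses an array with m = ⌈(1+ε)·n⌉ middle cells and has cost at most C·(log₂ n)²/ε on every sequence of n elements of [0,1]. -/
/-!
Online sorting with known range: a sequence of `n` reals in `[0,1]` arrives online and a
deterministic algorithm places each element irrevocably in an empty cell of an array of
`m + 2` cells whose two extreme cells hold the sentinels `0` and `1`.  The cost of the final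
configuration is the sum of `|x - y|` over consecutive non-empty cells.

STATEMENT 0: there are absolute constants `C, C₀ > 0` such that for every `n ≥ 2` and every
`ε` with `C₀ log₂ n / n ≤ ε ≤ 1` there is a deterministic online algorithm with
`m = ⌈(1+ε) n⌉` middle cells whose cost is at most `C (log₂ n)² / ε` on every input.
-/

noncomputable section
attribute [local instance] Classical.propDecidable

/-- Cost of a configuration `g` of optional values in cells `0, …, N-1`: the sum of
`|x - y|` over all pairs of values occupying consecutive non-empty cells. -/
def configCost {N : ℕ} (g : Fin N → Option ℝ) : ℝ :=
  ∑ i : Fin N, ∑ j : Fin N,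
    if (g i).isSome = true ∧ (g j).isSome = true ∧ i < j ∧
        (∀ k : Fin N, i < k → k < j → g k = none) then
      |(g i).getD 0 - (g j).getD 0|
    else 0

/-- The cell in which the deterministic online algorithm `strat` (which sees exactly the
elements revealed so far) places the `t`-th element of the input sequence `a`. -/
def place {n m : ℕ} (strat : List ℝ → Fin m) (a : Fin n → ℝ) (t : Fin n) : Fin m :=
  strat ((List.ofFn a).take (t.1 + 1))

/-- The final configuration of the array with `m` middle cells and sentinels `0` and `1`
at the two ends, when element `a t` has been placed in middle cell `pl t`. -/
def withSentinels {n m : ℕ} (a : Fin n → ℝ) (pl : Fin n → Fin m) :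
    Fin (m + 2) → Option ℝ := fun i =>
  if i.1 = 0 then some 0
  else if i.1 = m + 1 then some 1
  else if h : ∃ t, (pl t).1 + 1 = i.1 then some (a h.choose) else none


/-- Block at height `k` around cell `c` is empty. -/
def EmptyBlk (S : Finset (ℕ × ℕ)) (k c : ℕ) : Prop :=
  ∀ p ∈ S, p.1 / 2 ^ k ≠ c / 2 ^ k

/-- Block at height `k` around cell `c` holds an element of node `v`. -/
def HasNode (S : Finset (ℕ × ℕ)) (k c v : ℕ) : Prop :=
  ∃ p ∈ S, p.1 / 2 ^ k = c / 2 ^ k ∧ p.2 / 2 ^ k = v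

structure OInv (L M : ℕ) (S : Finset (ℕ × ℕ)) : Prop where
  cell : ∀ p ∈ S, p.1 < M
  lab : ∀ p ∈ S, p.2 < 2 ^ L
  pure : ∀ p ∈ S, ∀ p' ∈ S, ∀ h ≤ L, p.1 / 2 ^ h = p'.1 / 2 ^ h → p.2 / 2 ^ h = p'.2 / 2 ^ h
  one : ∀ k < L, ∀ c c' v, EmptyBlk S k c → HasNode S (k + 1) c v →
    EmptyBlk S k c' → HasNode S (k + 1) c' v → c / 2 ^ (k + 1) = c' / 2 ^ (k + 1)

lemma div_pow_mono {a b k h : ℕ} (hkh : k ≤ h) (e : a / 2 ^ k = b / 2 ^ k) :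
    a / 2 ^ h = b / 2 ^ h := by
  obtain ⟨r, rfl⟩ := Nat.exists_eq_add_of_le hkh
  rw [pow_add, ← Nat.div_div_eq_div_mul, ← Nat.div_div_eq_div_mul, e]

lemma inv_empty (L M : ℕ) : OInv L M ∅ := by
  refine ⟨by simp, by simp, by simp, ?_⟩
  intro k hk c c' v _ h
  obtain ⟨p, hp, _⟩ := h
  simp at hp

lemma root_free {L M R n : ℕ} {S : Finset (ℕ × ℕ)} (hI : OInv L M S) (hM : M = R * 2 ^ L)
    (hn : n + L * 2 ^ L ≤ M) (hS : S.card < n) : ∃ c < M, EmptyBlk S L c := by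
  by_contra hcon
  push Not at hcon
  have key : Finset.range M ⊆ S.image Prod.fst ∪
      (Finset.range L).biUnion (fun k => (Finset.range (2 ^ (L - (k + 1)))).biUnion
        (fun v => (Finset.range M).filter (fun c => EmptyBlk S k c ∧ HasNode S (k + 1) c v))) := by
    intro c hc
    have hcM := Finset.mem_range.1 hc
    by_cases hc0 : EmptyBlk S 0 c
    · apply Finset.mem_union_right
      have hex : ∃ h, ¬ EmptyBlk S h c := ⟨L, hcon c hcM⟩
      have h1 := Nat.find_spec hex
      have hle : Nat.find hex ≤ L := Nat.find_min' hex (hcon c hcM)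
      have hmin := fun k => Nat.find_min hex (m := k)
      generalize Nat.find hex = h at *
      cases h with
      | zero => exact absurd hc0 h1
      | succ k =>
        have hk : EmptyBlk S k c := by
          have := hmin k (Nat.lt_succ_self k)
          push Not at this
          exact this
        have h2 := h1
        unfold EmptyBlk at h2
        push Not at h2
        obtain ⟨p, hp, hpe⟩ := h2
        simp only [Finset.mem_biUnion, Finset.mem_range, Finset.mem_filter]
        refine ⟨k, hle, p.2 / 2 ^ (k + 1), ?_, hcM, hk, p, hp, hpe, rfl⟩
        rw [Nat.div_lt_iff_lt_mul (by positivity), ← pow_add, Nat.sub_add_cancel hle]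
        exact hI.lab p hp
    · apply Finset.mem_union_left
      unfold EmptyBlk at hc0
      push Not at hc0
      obtain ⟨p, hp, hpe⟩ := hc0
      simp only [pow_zero, Nat.div_one] at hpe
      exact Finset.mem_image.2 ⟨p, hp, hpe⟩
  have hcard := Finset.card_le_card key
  rw [Finset.card_range] at hcard
  have h1 : (S.image Prod.fst).card ≤ S.card := Finset.card_image_le
  have h2 : ((Finset.range L).biUnion (fun k => (Finset.range (2 ^ (L - (k + 1)))).biUnion
        (fun v => (Finset.range M).filter
          (fun c => EmptyBlk S k c ∧ HasNode S (k + 1) c v)))).card ≤ L * 2 ^ L := by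
    have := Finset.card_biUnion_le_card_mul (Finset.range L)
      (fun k => (Finset.range (2 ^ (L - (k + 1)))).biUnion
        (fun v => (Finset.range M).filter
          (fun c => EmptyBlk S k c ∧ HasNode S (k + 1) c v))) (2 ^ L) ?_
    · simpa using this
    intro k hk
    have hk := Finset.mem_range.1 hk
    have := Finset.card_biUnion_le_card_mul (Finset.range (2 ^ (L - (k + 1))))
      (fun v => (Finset.range M).filter
          (fun c => EmptyBlk S k c ∧ HasNode S (k + 1) c v)) (2 ^ (k + 1)) ?_
    · rw [Finset.card_range, ← pow_add, Nat.sub_add_cancel hk] at this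
      exact this
    intro v _
    rcases Finset.eq_empty_or_nonempty ((Finset.range M).filter
          (fun c => EmptyBlk S k c ∧ HasNode S (k + 1) c v)) with he | ⟨c0, hc0⟩
    · rw [he]; simp
    · have hc0 := (Finset.mem_filter.1 hc0).2
      have hsub : (Finset.range M).filter (fun c => EmptyBlk S k c ∧ HasNode S (k + 1) c v) ⊆
          Finset.Ico (c0 / 2 ^ (k + 1) * 2 ^ (k + 1))
            (c0 / 2 ^ (k + 1) * 2 ^ (k + 1) + 2 ^ (k + 1)) := by
        intro c hc
        have hc := (Finset.mem_filter.1 hc).2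
        have := hI.one k hk c c0 v hc.1 hc.2 hc0.1 hc0.2
        rw [← this, Finset.mem_Ico]
        have h3 := Nat.div_add_mod' c (2 ^ (k + 1))
        have h4 := Nat.mod_lt c (show 0 < 2 ^ (k + 1) by positivity)
        omega
      have := Finset.card_le_card hsub
      simpa using this
  have h3 := Finset.card_union_le (S.image Prod.fst)
    ((Finset.range L).biUnion (fun k => (Finset.range (2 ^ (L - (k + 1)))).biUnion
        (fun v => (Finset.range M).filter
          (fun c => EmptyBlk S k c ∧ HasNode S (k + 1) c v))))
  omega

lemma step_exists {L M R n q : ℕ} {S : Finset (ℕ × ℕ)} (hI : OInv L M S) (hM : M = R * 2 ^ L)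
    (hn : n + L * 2 ^ L ≤ M) (hS : S.card < n) (hq : q < 2 ^ L) :
    ∃ c < M, (∀ p ∈ S, p.1 ≠ c) ∧ OInv L M (insert (c, q) S) := by
  have hex : ∃ k, ∃ c < M, EmptyBlk S k c ∧ (k = L ∨ (k < L ∧ HasNode S (k + 1) c (q / 2 ^ (k + 1)))) := by
    obtain ⟨c, hc, he⟩ := root_free hI hM hn hS
    exact ⟨L, c, hc, he, Or.inl rfl⟩
  have h1 := Nat.find_spec hex
  have hmin := fun k => Nat.find_min hex (m := k)
  generalize Nat.find hex = k at *
  obtain ⟨c, hc, he, hk⟩ := h1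
  have hkL : k ≤ L := by omega
  have hsmall : ∀ h ≤ k, EmptyBlk S h c := fun h hh p hp e => he p hp (div_pow_mono hh e)
  have hbig : ∀ h ≤ L, k < h → ∃ p ∈ S, p.1 / 2 ^ h = c / 2 ^ h ∧ p.2 / 2 ^ h = q / 2 ^ h := by
    intro h hh hkh
    rcases hk with rfl | ⟨_, p, hp, e1, e2⟩
    · omega
    · exact ⟨p, hp, div_pow_mono hkh e1, div_pow_mono hkh e2⟩
  have hpure : ∀ p ∈ S, ∀ h ≤ L, p.1 / 2 ^ h = c / 2 ^ h → p.2 / 2 ^ h = q / 2 ^ h := by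
    intro p hp h hh e
    by_cases hkh : k < h
    · obtain ⟨p', hp', e1, e2⟩ := hbig h hh hkh
      rw [← e2]
      exact hI.pure p hp p' hp' h hh (e.trans e1.symm)
    · exact absurd e (hsmall h (by omega) p hp)
  refine ⟨c, hc, ?_, ?_, ?_, ?_, ?_⟩
  · intro p hp e
    exact hsmall 0 (Nat.zero_le _) p hp (by rw [e])
  · intro p hp
    rcases Finset.mem_insert.1 hp with rfl | hp
    · exact hc
    · exact hI.cell p hp
  · intro p hp
    rcases Finset.mem_insert.1 hp with rfl | hp
    · exact hq
    · exact hI.lab p hp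
  · intro p hp p' hp' h hh e
    rcases Finset.mem_insert.1 hp with rfl | hp <;> rcases Finset.mem_insert.1 hp' with rfl | hp'
    · rfl
    · exact (hpure p' hp' h hh e.symm).symm
    · exact hpure p hp h hh e
    · exact hI.pure p hp p' hp' h hh e
  · intro j hj c1 c2 v E1 N1 E2 N2
    have Eold : ∀ x, EmptyBlk (insert (c, q) S) j x → EmptyBlk S j x :=
      fun x hx p hp => hx p (Finset.mem_insert_of_mem hp)
    -- either old node, or the block of c is fresh
    have Nold : ∀ x, HasNode (insert (c, q) S) (j + 1) x v → HasNode S (j + 1) x v ∨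
        (c / 2 ^ (j + 1) = x / 2 ^ (j + 1) ∧ q / 2 ^ (j + 1) = v ∧ j < k) := by
      rintro x ⟨p, hp, e1, e2⟩
      rcases Finset.mem_insert.1 hp with rfl | hp
      · by_cases hjk : j < k
        · exact Or.inr ⟨e1, e2, hjk⟩
        · obtain ⟨p', hp', e1', e2'⟩ := hbig (j + 1) hj (by omega)
          exact Or.inl ⟨p', hp', e1'.trans e1, e2'.trans e2⟩
      · exact Or.inl ⟨p, hp, e1, e2⟩
    have bound : ∀ x, HasNode S (j + 1) x v → x < M := by
      rintro x ⟨p, hp, e1, e2⟩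
      have h1 := hI.cell p hp
      have e3 := div_pow_mono (show j + 1 ≤ L from hj) e1
      rw [hM] at h1 ⊢
      rw [← Nat.div_lt_iff_lt_mul (by positivity)] at h1 ⊢
      omega
    rcases Nold c1 N1 with N1 | ⟨a1, b1, d1⟩ <;> rcases Nold c2 N2 with N2 | ⟨a2, b2, d2⟩
    · exact hI.one j hj c1 c2 v (Eold _ E1) N1 (Eold _ E2) N2
    · exact absurd ⟨c1, bound c1 N1, Eold _ E1, Or.inr ⟨hj, b2 ▸ N1⟩⟩ (hmin j d2)
    · exact absurd ⟨c2, bound c2 N2, Eold _ E2, Or.inr ⟨hj, b1 ▸ N2⟩⟩ (hmin j d1)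
    · exact a1.symm.trans a2

def pick (L M : ℕ) (S : Finset (ℕ × ℕ)) (q : ℕ) : ℕ :=
  if h : ∃ c < M, (∀ p ∈ S, p.1 ≠ c) ∧ OInv L M (insert (c, q) S) then h.choose else 0

def labl (L : ℕ) (x : ℝ) : ℕ := min ⌊x * 2 ^ L⌋₊ (2 ^ L - 1)

def runS (L M : ℕ) (l : List ℝ) : Finset (ℕ × ℕ) :=
  l.foldl (fun S x => insert (pick L M S (labl L x), labl L x) S) ∅

lemma runS_append (L M : ℕ) (l : List ℝ) (x : ℝ) : runS L M (l ++ [x]) =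
    insert (pick L M (runS L M l) (labl L x), labl L x) (runS L M l) := by
  simp [runS]

lemma labl_lt (L : ℕ) (x : ℝ) : labl L x < 2 ^ L := by
  have : 0 < 2 ^ L := by positivity
  unfold labl
  omega

lemma pick_spec {L M R n q : ℕ} {S : Finset (ℕ × ℕ)} (hI : OInv L M S) (hM : M = R * 2 ^ L)
    (hn : n + L * 2 ^ L ≤ M) (hS : S.card < n) (hq : q < 2 ^ L) :
    pick L M S q < M ∧ (∀ p ∈ S, p.1 ≠ pick L M S q) ∧ OInv L M (insert (pick L M S q, q) S) := by
  have h := step_exists hI hM hn hS hq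
  unfold pick
  rw [dif_pos h]
  exact h.choose_spec

lemma runS_inv {L M R n : ℕ} (hM : M = R * 2 ^ L) (hn : n + L * 2 ^ L ≤ M) (l : List ℝ)
    (hl : l.length ≤ n) : OInv L M (runS L M l) ∧ (runS L M l).card = l.length := by
  induction l using List.reverseRecOn with
  | nil => exact ⟨inv_empty L M, by simp [runS]⟩
  | append_singleton l x ih =>
    simp only [List.length_append, List.length_singleton] at hl
    obtain ⟨h1, h2⟩ := ih (by omega)
    obtain ⟨-, h4, h5⟩ := pick_spec h1 hM hn (by omega) (labl_lt L x)
    rw [runS_append]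
    refine ⟨h5, ?_⟩
    rw [Finset.card_insert_of_notMem, h2]
    · simp
    · intro hmem
      exact h4 _ hmem rfl

lemma runS_mono (L M : ℕ) (l l' : List ℝ) : runS L M l ⊆ runS L M (l ++ l') := by
  induction l' using List.reverseRecOn with
  | nil => simp
  | append_singleton l' x ih =>
    rw [← List.append_assoc, runS_append]
    exact ih.trans (Finset.subset_insert _ _)

lemma labl_close {L h : ℕ} {x y : ℝ} (hx : x ∈ Set.Icc (0 : ℝ) 1) (hy : y ∈ Set.Icc (0 : ℝ) 1)
    (e : labl L x / 2 ^ h = labl L y / 2 ^ h) : |x - y| ≤ 2 ^ h / 2 ^ L := by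
  have key : ∀ z ∈ Set.Icc (0 : ℝ) 1, (labl L z : ℝ) ≤ z * 2 ^ L ∧ z * 2 ^ L ≤ labl L z + 1 := by
    intro z hz
    have hp : (0 : ℝ) < 2 ^ L := by positivity
    have hz0 : 0 ≤ z * 2 ^ L := mul_nonneg hz.1 hp.le
    have hfl := Nat.floor_le hz0
    have hlt := Nat.lt_floor_add_one (z * 2 ^ L)
    constructor
    · refine le_trans ?_ hfl
      exact Nat.cast_le.2 (min_le_left _ _)
    · rcases min_choice ⌊z * 2 ^ L⌋₊ (2 ^ L - 1) with hm | hm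
      · unfold labl; rw [hm]; exact hlt.le
      · unfold labl; rw [hm]
        have : 1 ≤ 2 ^ L := Nat.one_le_two_pow
        push_cast [this]
        nlinarith [hz.2]
  have key2 : ∀ q : ℕ, ((q / 2 ^ h : ℕ) : ℝ) * 2 ^ h ≤ q ∧
      (q : ℝ) + 1 ≤ ((q / 2 ^ h : ℕ) : ℝ) * 2 ^ h + 2 ^ h := by
    intro q
    have h3 := Nat.div_add_mod' q (2 ^ h)
    have h4 := Nat.mod_lt q (show 0 < 2 ^ h by positivity)
    constructor
    · exact_mod_cast (by omega : q / 2 ^ h * 2 ^ h ≤ q)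
    · exact_mod_cast (by omega : q + 1 ≤ q / 2 ^ h * 2 ^ h + 2 ^ h)
  have hp : (0 : ℝ) < 2 ^ L := by positivity
  have habs : |x - y| * 2 ^ L = |(x - y) * 2 ^ L| := by rw [abs_mul, abs_of_pos hp]
  rw [le_div_iff₀ hp, habs, abs_le]
  obtain ⟨a1, a2⟩ := key x hx
  obtain ⟨b1, b2⟩ := key y hy
  obtain ⟨c1, c2⟩ := key2 (labl L x)
  obtain ⟨d1, d2⟩ := key2 (labl L y)
  rw [e] at c1 c2
  constructor <;> nlinarith

lemma configCost_le {N : ℕ} (g : Fin N → Option ℝ) (W : ℕ → ℝ) (hW : ∀ b, 0 ≤ W b)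
    (hg : ∀ i j : Fin N, (g i).isSome = true → (g j).isSome = true → i < j →
      |(g i).getD 0 - (g j).getD 0| ≤ ∑ b ∈ Finset.Ico i.1 j.1, W b) :
    configCost g ≤ ∑ b ∈ Finset.range (N - 1), W b := by
  unfold configCost
  set P : Fin N × Fin N → Prop := fun p => (g p.1).isSome = true ∧ (g p.2).isSome = true ∧
    p.1 < p.2 ∧ (∀ k : Fin N, p.1 < k → k < p.2 → g k = none) with hP
  rw [← Fintype.sum_prod_type' (f := fun i j => if (g i).isSome = true ∧ (g j).isSome = true ∧ i < j ∧
        (∀ k : Fin N, i < k → k < j → g k = none) then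
      |(g i).getD 0 - (g j).getD 0|
    else 0)]
  have e1 : (∑ p : Fin N × Fin N, if (g p.1).isSome = true ∧ (g p.2).isSome = true ∧ p.1 < p.2 ∧
        (∀ k : Fin N, p.1 < k → k < p.2 → g k = none) then
      |(g p.1).getD 0 - (g p.2).getD 0| else 0) =
      ∑ p ∈ Finset.univ.filter P, |(g p.1).getD 0 - (g p.2).getD 0| := by
    rw [Finset.sum_filter]
  rw [e1]
  calc ∑ p ∈ Finset.univ.filter P, |(g p.1).getD 0 - (g p.2).getD 0|
      ≤ ∑ p ∈ Finset.univ.filter P, ∑ b ∈ Finset.Ico p.1.1 p.2.1, W b := by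
        apply Finset.sum_le_sum
        intro p hp
        obtain ⟨h1, h2, h3, -⟩ := (Finset.mem_filter.1 hp).2
        exact hg _ _ h1 h2 h3
    _ = ∑ b ∈ (Finset.univ.filter P).biUnion (fun p => Finset.Ico p.1.1 p.2.1), W b := by
        rw [Finset.sum_biUnion]
        rintro ⟨i, j⟩ hp ⟨i', j'⟩ hp' hne
        obtain ⟨h1, h2, h3, h4⟩ := (Finset.mem_filter.1 hp).2
        obtain ⟨h1', h2', h3', h4'⟩ := (Finset.mem_filter.1 hp').2
        simp only at h1 h2 h3 h4 h1' h2' h3' h4'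
        rw [Function.onFun, Finset.disjoint_left]
        intro b hb hb'
        simp only [Finset.mem_Ico] at hb hb'
        apply hne
        have A : i = i' := by
          rcases lt_trichotomy i i' with h | h | h
          · have := h4 i' h (Fin.lt_def.2 (by omega))
            simp [this] at h1'
          · exact h
          · have := h4' i h (Fin.lt_def.2 (by omega))
            simp [this] at h1
        have B : j = j' := by
          rcases lt_trichotomy j j' with h | h | h
          · have := h4' j (Fin.lt_def.2 (by omega)) h
            simp [this] at h2
          · exact h
          · have := h4 j' (Fin.lt_def.2 (by omega)) h
            simp [this] at h2'
        rw [A, B]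
    _ ≤ ∑ b ∈ Finset.range (N - 1), W b := by
        apply Finset.sum_le_sum_of_subset_of_nonneg
        · intro b hb
          obtain ⟨p, -, hb⟩ := Finset.mem_biUnion.1 hb
          have := p.2.2
          simp only [Finset.mem_Ico] at hb
          rw [Finset.mem_range]
          omega
        · intro b _ _
          exact hW b

def wt (L m b : ℕ) : ℝ := (if b = m then 1 else 0) +
  ∑ k ∈ Finset.range (L + 1), if 2 ^ k ∣ b then (2 : ℝ) ^ (k + 1) / 2 ^ L else 0

lemma wt_nonneg (L m b : ℕ) : 0 ≤ wt L m b := by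
  unfold wt
  apply add_nonneg
  · split_ifs <;> norm_num
  · apply Finset.sum_nonneg
    intro k _
    split_ifs <;> positivity

lemma wt_ge (L m b k : ℕ) (hk : k ≤ L) (hb : 2 ^ k ∣ b) : (2 : ℝ) ^ (k + 1) / 2 ^ L ≤ wt L m b := by
  unfold wt
  have h1 : (0 : ℝ) ≤ if b = m then 1 else 0 := by split_ifs <;> norm_num
  have h2 := Finset.single_le_sum (s := Finset.range (L + 1))
    (f := fun k => if 2 ^ k ∣ b then (2 : ℝ) ^ (k + 1) / 2 ^ L else 0)
    (by intro i _; split_ifs <;> positivity) (Finset.mem_range.2 (Nat.lt_succ_of_le hk))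
  simp only [hb, if_true] at h2
  linarith

lemma wt_m (L m : ℕ) : 1 ≤ wt L m m := by
  unfold wt
  rw [if_pos rfl]
  have : (0 : ℝ) ≤ ∑ k ∈ Finset.range (L + 1), if 2 ^ k ∣ m then (2 : ℝ) ^ (k + 1) / 2 ^ L else 0 := by
    apply Finset.sum_nonneg
    intro k _
    split_ifs <;> positivity
  linarith

lemma wt_sum (L m : ℕ) (hm : 2 ^ L ≤ m) :
    ∑ b ∈ Finset.range (m + 1), wt L m b ≤ 1 + (L + 1) * (4 * m / 2 ^ L) := by
  unfold wt
  rw [Finset.sum_add_distrib, Finset.sum_comm]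
  apply add_le_add
  · simp
  · calc _ ≤ ∑ k ∈ Finset.range (L + 1), (4 * (m : ℝ) / 2 ^ L) := by
          apply Finset.sum_le_sum
          intro k hk
          have hk : k ≤ L := Nat.lt_succ_iff.1 (Finset.mem_range.1 hk)
          rw [← Finset.sum_filter, Finset.sum_const, nsmul_eq_mul]
          have hc : ((Finset.range (m + 1)).filter (fun b => 2 ^ k ∣ b)).card ≤ m / 2 ^ k + 1 := by
            rw [← Finset.card_range (m / 2 ^ k + 1)]
            apply Finset.card_le_card_of_injOn (fun b => b / 2 ^ k)
            · intro b hb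
              have hb := Finset.mem_filter.1 hb
              have h1 := Finset.mem_range.1 hb.1
              simp only [Finset.coe_range, Set.mem_Iio]
              exact Nat.lt_succ_of_le (Nat.div_le_div_right (by omega))
            · intro b hb b' hb' e
              have hb := (Finset.mem_filter.1 hb).2
              have hb' := (Finset.mem_filter.1 hb').2
              simp only at e
              rw [← Nat.div_mul_cancel hb, ← Nat.div_mul_cancel hb', e]
          have hk2 : 2 ^ k ≤ m := (Nat.pow_le_pow_right (by norm_num) hk).trans hm
          have h3 : (m / 2 ^ k + 1) * 2 ^ k ≤ 2 * m := by
            have := Nat.div_mul_le_self m (2 ^ k)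
            rw [add_mul]
            omega
          have h4 : ((Finset.range (m + 1)).filter (fun b => 2 ^ k ∣ b)).card * 2 ^ (k + 1)
              ≤ 4 * m := by
            calc _ ≤ (m / 2 ^ k + 1) * 2 ^ (k + 1) := Nat.mul_le_mul_right _ hc
              _ ≤ 4 * m := by rw [pow_succ]; linarith
          rw [← mul_div_assoc]
          apply div_le_div_of_nonneg_right _ (by positivity)
          exact_mod_cast h4
      _ = _ := by simp

lemma exists_boundary {k c c' : ℕ} (hlt : c < c') (hne : c / 2 ^ k ≠ c' / 2 ^ k) :
    ∃ b, 2 ^ k ∣ b ∧ c < b ∧ b ≤ c' := by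
  refine ⟨c' / 2 ^ k * 2 ^ k, Dvd.intro_left _ rfl, ?_, Nat.div_mul_le_self _ _⟩
  rw [← Nat.div_lt_iff_lt_mul (by positivity)]
  exact lt_of_le_of_ne (Nat.div_le_div_right hlt.le) hne

lemma cost_bound {n m L : ℕ} (a : Fin n → ℝ) (pl : Fin n → Fin m)
    (ha : ∀ t, a t ∈ Set.Icc (0 : ℝ) 1) (hm : 2 ^ L ≤ m)
    (hp : ∀ t s, ∀ h ≤ L, (pl t).1 / 2 ^ h = (pl s).1 / 2 ^ h →
      labl L (a t) / 2 ^ h = labl L (a s) / 2 ^ h) :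
    configCost (withSentinels a pl) ≤ 1 + (L + 1) * (4 * m / 2 ^ L) := by
  refine le_trans (configCost_le _ (wt L m) (wt_nonneg L m) ?_) (wt_sum L m hm)
  intro i j hi hj hij
  have hij' : i.1 < j.1 := hij
  have single : ∀ b, i.1 ≤ b → b < j.1 → wt L m b ≤ ∑ b ∈ Finset.Ico i.1 j.1, wt L m b := by
    intro b h1 h2
    exact Finset.single_le_sum (f := wt L m) (fun b _ => wt_nonneg L m b) (Finset.mem_Ico.2 ⟨h1, h2⟩)
  have val : ∀ i, (withSentinels a pl i).getD 0 ∈ Set.Icc (0 : ℝ) 1 := by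
    intro i
    unfold withSentinels
    split_ifs
    · simp
    · simp
    · exact ha _
    · simp
  have one : |(withSentinels a pl i).getD 0 - (withSentinels a pl j).getD 0| ≤ 1 := by
    have h1 := val i
    have h2 := val j
    rw [abs_le]
    constructor <;> linarith [h1.1, h1.2, h2.1, h2.2]
  have hpL : (0 : ℝ) < 2 ^ L := by positivity
  have big : ∀ b, 2 ^ L ∣ b → 1 ≤ wt L m b := by
    intro b hb
    refine le_trans ?_ (wt_ge L m b L le_rfl hb)
    rw [pow_succ, le_div_iff₀ hpL]
    linarith
  by_cases hi0 : i.1 = 0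
  · exact one.trans ((big 0 (dvd_zero _)).trans (single 0 (by omega) (by omega)))
  by_cases hjm : j.1 = m + 1
  · exact one.trans ((wt_m L m).trans (single m (by omega) (by omega)))
  have get : ∀ i : Fin (m + 2), i.1 ≠ 0 → i.1 ≠ m + 1 → (withSentinels a pl i).isSome = true →
      ∃ t, (pl t).1 + 1 = i.1 ∧ (withSentinels a pl i).getD 0 = a t := by
    intro i h1 h2 h3
    unfold withSentinels at h3 ⊢
    rw [if_neg h1, if_neg h2] at h3 ⊢
    by_cases h : ∃ t, (pl t).1 + 1 = i.1
    · rw [dif_pos h]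
      exact ⟨h.choose, h.choose_spec, rfl⟩
    · rw [dif_neg h] at h3
      simp at h3
  obtain ⟨t, ht, et⟩ := get i hi0 (by have := j.2; omega) hi
  obtain ⟨s, hs, es⟩ := get j (by omega) hjm hj
  by_cases hL : (pl t).1 / 2 ^ L = (pl s).1 / 2 ^ L
  · have hex : ∃ h, (pl t).1 / 2 ^ h = (pl s).1 / 2 ^ h := ⟨L, hL⟩
    have h1 := Nat.find_spec hex
    have hle : Nat.find hex ≤ L := Nat.find_min' hex hL
    have hmin := fun k => Nat.find_min hex (m := k)
    generalize Nat.find hex = h at *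
    cases h with
    | zero =>
      simp only [pow_zero, Nat.div_one] at h1
      omega
    | succ k =>
      obtain ⟨b, hb, hb1, hb2⟩ := exists_boundary (k := k) (show (pl t).1 < (pl s).1 by omega)
        (hmin k (Nat.lt_succ_self k))
      rw [et, es]
      exact (labl_close (ha t) (ha s) (hp t s (k + 1) hle h1)).trans
        ((wt_ge L m b k (by omega) hb).trans (single b (by omega) (by omega)))
  · obtain ⟨b, hb, hb1, hb2⟩ := exists_boundary (show (pl t).1 < (pl s).1 by omega) hL
    exact one.trans ((big b hb).trans (single b (by omega) (by omega)))

lemma core {n m L : ℕ} (hm0 : 0 < m) (h : n + (L + 1) * 2 ^ L ≤ m) :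
    ∃ strat : List ℝ → Fin m, ∀ a : Fin n → ℝ, (∀ t, a t ∈ Set.Icc (0 : ℝ) 1) →
      Function.Injective (place strat a) ∧
      configCost (withSentinels a (place strat a)) ≤ 1 + (L + 1) * (4 * m / 2 ^ L) := by
  set R := m / 2 ^ L with hR
  set M := R * 2 ^ L with hM
  have hMm : M ≤ m := Nat.div_mul_le_self _ _
  have hpos : 0 < 2 ^ L := by positivity
  have hn : n + L * 2 ^ L ≤ M := by
    have h3 := Nat.div_add_mod' m (2 ^ L)
    have h4 := Nat.mod_lt m hpos
    rw [add_mul] at h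
    rw [← hR, ← hM] at h3
    omega
  have hmL : 2 ^ L ≤ m := by
    rw [add_mul] at h
    omega
  refine ⟨fun l => if hlt : pick L M (runS L M l.dropLast) (labl L (l.getLastD 0)) < m then
    ⟨_, hlt⟩ else ⟨0, hm0⟩, ?_⟩
  intro a ha
  set strat : List ℝ → Fin m := fun l =>
    if hlt : pick L M (runS L M l.dropLast) (labl L (l.getLastD 0)) < m then
    ⟨_, hlt⟩ else ⟨0, hm0⟩ with hstrat
  set l := List.ofFn a with hl
  have hlen : l.length = n := by simp [hl]
  have htake : ∀ t : Fin n, l.take (t.1 + 1) = l.take t.1 ++ [a t] := by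
    intro t
    rw [List.take_add_one]
    congr 1
    simp [hl]
  have hspec : ∀ t : Fin n, _ := fun t => runS_inv hM hn (l.take t.1)
    (by rw [List.length_take]; omega)
  have hpk : ∀ t : Fin n, _ := fun t => pick_spec (hspec t).1 hM hn
    (by rw [(hspec t).2, List.length_take]; omega) (labl_lt L (a t))
  have hpl : ∀ t : Fin n, (place strat a t).1 = pick L M (runS L M (l.take t.1)) (labl L (a t)) := by
    intro t
    unfold place
    rw [← hl, htake, hstrat]
    simp only [List.dropLast_concat, List.getLastD_concat]
    rw [dif_pos ((hpk t).1.trans_le hMm)]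
  have hmem : ∀ t : Fin n, ((place strat a t).1, labl L (a t)) ∈ runS L M (l.take (t.1 + 1)) := by
    intro t
    rw [htake, runS_append, hpl]
    exact Finset.mem_insert_self _ _
  have hne : ∀ t s : Fin n, t < s → place strat a t ≠ place strat a s := by
    intro t s hts e
    have hts' : t.1 + 1 ≤ s.1 := hts
    have hsub : runS L M (l.take (t.1 + 1)) ⊆ runS L M (l.take s.1) := by
      have : l.take s.1 = l.take (t.1 + 1) ++ (l.take s.1).drop (t.1 + 1) := by
        conv_lhs => rw [← List.take_append_drop (t.1 + 1) (l.take s.1)]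
        rw [List.take_take, min_eq_left hts']
      rw [this]
      exact runS_mono _ _ _ _
    refine (hpk s).2.1 _ (hsub (hmem t)) ?_
    rw [← hpl, e]
  refine ⟨?_, cost_bound a _ ha hmL ?_⟩
  · intro t s e
    rcases lt_trichotomy t s with h | h | h
    · exact absurd e (hne _ _ h)
    · exact h
    · exact absurd e.symm (hne _ _ h)
  · have hfull := (runS_inv hM hn l hlen.le).1
    have hmem' : ∀ t : Fin n, ((place strat a t).1, labl L (a t)) ∈ runS L M l := by
      intro t
      have := runS_mono L M (l.take (t.1 + 1)) (l.drop (t.1 + 1))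
      rw [List.take_append_drop] at this
      exact this (hmem t)
    intro t s h hh e
    exact hfull.pure _ (hmem' t) _ (hmem' s) h hh e

theorem statement0 :
    ∃ C C₀ : ℝ, 0 < C ∧ 0 < C₀ ∧
      ∀ n : ℕ, 2 ≤ n → ∀ ε : ℝ,
        C₀ * Real.logb 2 n / n ≤ ε → ε ≤ 1 →
        ∃ strat : List ℝ → Fin ⌈(1 + ε) * (n : ℝ)⌉₊,
          ∀ a : Fin n → ℝ, (∀ t, a t ∈ Set.Icc (0 : ℝ) 1) →
            Function.Injective (place strat a) ∧
            configCost (withSentinels a (place strat a)) ≤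
              C * (Real.logb 2 n) ^ 2 / ε := by
  refine ⟨1000, 4, by norm_num, by norm_num, ?_⟩
  intro n hn ε hε hε1
  have hnR : (2 : ℝ) ≤ n := by exact_mod_cast hn
  have hn0 : (0 : ℝ) < n := by linarith
  set l := Real.logb 2 n with hl
  have hl1 : 1 ≤ l := by
    rw [hl, Real.le_logb_iff_rpow_le (by norm_num) hn0]
    simpa using hnR
  have hεn : 4 * l ≤ ε * n := by
    rwa [div_le_iff₀ hn0] at hε
  have hε0 : 0 < ε := by
    by_contra hc
    push Not at hc
    nlinarith
  have hy1 : 1 ≤ ε * n / (4 * l) := by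
    rw [le_div_iff₀ (by linarith)]
    linarith
  obtain ⟨L, hL1, hL2⟩ := exists_nat_pow_near hy1 (by norm_num : (1 : ℝ) < 2)
  rw [le_div_iff₀ (by linarith)] at hL1
  rw [div_lt_iff₀ (by linarith)] at hL2
  have hp : (0 : ℝ) < 2 ^ L := by positivity
  have hLl : (L : ℝ) ≤ l := by
    rw [hl, Real.le_logb_iff_rpow_le (by norm_num) hn0, Real.rpow_natCast]
    nlinarith
  have hL0 : (0 : ℝ) ≤ L := Nat.cast_nonneg L
  have hcap : ((L : ℝ) + 1) * 2 ^ L ≤ ε * n := by nlinarith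
  have hmge := Nat.le_ceil ((1 + ε) * (n : ℝ))
  have hmlt := Nat.ceil_lt_add_one (show 0 ≤ (1 + ε) * (n : ℝ) by positivity)
  generalize ⌈(1 + ε) * (n : ℝ)⌉₊ = m at *
  have hm0 : 0 < m := by
    have : (0 : ℝ) < m := by nlinarith
    exact_mod_cast this
  have hcapN : n + (L + 1) * 2 ^ L ≤ m := by
    have : (n : ℝ) + ((L : ℝ) + 1) * 2 ^ L ≤ m := by nlinarith
    exact_mod_cast this
  obtain ⟨strat, hs⟩ := core hm0 hcapN
  refine ⟨strat, fun a ha => ⟨(hs a ha).1, (hs a ha).2.trans ?_⟩⟩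
  have hm3 : (m : ℝ) ≤ 3 * n := by nlinarith
  have h1 : 4 * (m : ℝ) / 2 ^ L ≤ 96 * l / ε := by
    rw [div_le_div_iff₀ hp hε0]
    rw [pow_succ] at hL2
    nlinarith
  have h2 : ((L : ℝ) + 1) * (4 * m / 2 ^ L) ≤ (2 * l) * (96 * l / ε) := by
    apply mul_le_mul _ h1 (by positivity) (by positivity)
    linarith
  have h3 : 1 ≤ l ^ 2 / ε := by
    rw [le_div_iff₀ hε0]
    nlinarith
  have h4 : (2 * l) * (96 * l / ε) = 192 * (l ^ 2 / ε) := by ring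
  rw [h4] at h2
  have h5 : 1000 * l ^ 2 / ε = 1000 * (l ^ 2 / ε) := by ring
  rw [h5]
  linarith
end
end

section
/- There exist absolute constants C, C₁ ≥ 1 such that for every integer n ≥ 2 and every real γ with C₁ ≤ γ ≤ (log₂ n)², there is a deterministic online sorting algorithm with known range that uses an array with at most C·γ·n middle cells and has cost at most C·(log₂ n)²/γ on every sequence of n elements of [0,1]. -/
/-!
Online sorting with known range (see stmt_0 for the model).

STATEMENT 1: there are absolute constants `C > 0` and `C₁ ≥ 1` such that for every `n ≥ 2`
and every `γ` with `C₁ ≤ γ ≤ (log₂ n)²` there is a deterministic online algorithm using at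
most `C γ n` middle cells whose cost is at most `C (log₂ n)² / γ` on every input.
-/

noncomputable section
attribute [local instance] Classical.propDecidable

/-! ### The tree allocator -/

def bsz (H y : ℕ) : ℕ := ∑ j ∈ Finset.range (H+1), if 2^j ∣ y then 2^j else 0

def bs (H x : ℕ) : ℕ := 1 + ∑ y ∈ Finset.range x, bsz H y

def own (H j x : ℕ) : ℕ := bs H (x * 2^j) + (2^j - 1)

def hsel (av : ℕ → ℕ → Option ℕ) (x : ℕ) : ℕ := sInf {j | av j (x / 2^j) ≠ none}

def psel (av : ℕ → ℕ → Option ℕ) (x : ℕ) : ℕ := (av (hsel av x) (x / 2^(hsel av x))).getD 0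

def upd (av : ℕ → ℕ → Option ℕ) (x : ℕ) : ℕ → ℕ → Option ℕ := fun j y =>
  if y = x / 2^j then
    (if j < hsel av x then some (psel av x + 2^j)
      else if j = hsel av x then none else av j y)
  else av j y

def av0 (H : ℕ) : ℕ → ℕ → Option ℕ := fun j x => some (own H j x)

def stt (H : ℕ) (x : ℕ → ℕ) : ℕ → ℕ → ℕ → Option ℕ
  | 0 => av0 H
  | t+1 => upd (stt H x t) (x t)

def tv (M : ℕ) (F : ℕ → ℝ) : ℝ := ∑ i ∈ Finset.range M, |F (i+1) - F i|

lemma tv_upd (M : ℕ) (F : ℕ → ℝ) (p l : ℕ) (v d : ℝ)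
    (hd : ∀ i, p ≤ i → i < p + l → F i = d) :
    tv M (fun i => if p ≤ i ∧ i < p + l then v else F i) ≤ tv M F + 2 * |v - d| := by
  have key : ∀ i, |(if p ≤ i+1 ∧ i+1 < p + l then v else F (i+1)) -
      (if p ≤ i ∧ i < p + l then v else F i)| ≤ |F (i+1) - F i| +
      ((if i + 1 = p then |v - d| else 0) + (if i + 1 = p + l then |v - d| else 0)) := by
    intro i
    have h0 := abs_nonneg (v - d)
    have h1 := abs_nonneg (F (i+1) - F i)
    by_cases c1 : p ≤ i+1 ∧ i+1 < p + l <;> by_cases c2 : p ≤ i ∧ i < p + l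
    · simp only [c1, c2, and_self, if_true, sub_self, abs_zero]
      positivity
    · rw [if_pos c1, if_neg c2, if_pos (by omega : i + 1 = p), if_neg (by omega)]
      have := hd (i+1) c1.1 c1.2
      rw [this, add_zero]
      calc |v - F i| = |(d - F i) + (v - d)| := by ring_nf
        _ ≤ _ := abs_add_le _ _
    · rw [if_neg c1, if_pos c2, if_neg (by omega), if_pos (by omega : i + 1 = p + l)]
      have := hd i c2.1 c2.2
      rw [this, zero_add]
      calc |F (i+1) - v| = |(F (i+1) - d) - (v - d)| := by ring_nf
        _ ≤ _ := abs_sub _ _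
    · rw [if_neg c1, if_neg c2]
      have : 0 ≤ ((if i + 1 = p then |v - d| else 0) + (if i + 1 = p + l then |v - d| else 0)) := by
        positivity
      linarith
  have ind : ∀ q, ∑ i ∈ Finset.range M, (if i + 1 = q then |v - d| else 0) ≤ |v - d| := by
    intro q
    calc _ ≤ ∑ i ∈ Finset.range M, (if q - 1 = i then |v - d| else 0) := by
          apply Finset.sum_le_sum
          intro i _
          by_cases h : i + 1 = q
          · rw [if_pos h, if_pos (by omega)]
          · rw [if_neg h]; positivity
      _ ≤ _ := by
          rw [Finset.sum_ite_eq]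
          split_ifs
          · exact le_rfl
          · exact abs_nonneg _
  unfold tv
  calc _ ≤ _ := Finset.sum_le_sum (fun i _ => key i)
    _ ≤ _ := by
      rw [Finset.sum_add_distrib, Finset.sum_add_distrib]
      have := ind p
      have := ind (p + l)
      linarith

lemma abs_sub_le_seg (F : ℕ → ℝ) (i j : ℕ) (h : i ≤ j) :
    |F i - F j| ≤ ∑ k ∈ Finset.Ico i j, |F (k+1) - F k| := by
  rw [← Finset.sum_Ico_sub F h |> fun e => (abs_sub_comm (F j) (F i)), ← Finset.sum_Ico_sub F h]
  exact Finset.abs_sum_le_sum_abs _ _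

lemma configCost_le_tv (M : ℕ) (g : Fin (M+1) → Option ℝ) (F : ℕ → ℝ)
    (hF : ∀ i, (g i).isSome = true → (g i).getD 0 = F i.1) :
    configCost g ≤ tv M F := by
  let P : Fin (M+1) → Fin (M+1) → Prop := fun i j =>
    (g i).isSome = true ∧ (g j).isSome = true ∧ i < j ∧
        (∀ k : Fin (M+1), i < k → k < j → g k = none)
  have h1 : configCost g ≤ ∑ i : Fin (M+1), ∑ j : Fin (M+1), ∑ k ∈ Finset.range M,
      if P i j ∧ i.1 ≤ k ∧ k < j.1 then |F (k+1) - F k| else 0 := by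
    unfold configCost
    refine Finset.sum_le_sum fun i _ => Finset.sum_le_sum fun j _ => ?_
    split_ifs with h
    · rw [hF i h.1, hF j h.2.1]
      refine (abs_sub_le_seg F i j (le_of_lt h.2.2.1)).trans ?_
      rw [← Finset.sum_filter]
      apply Finset.sum_le_sum_of_subset_of_nonneg
      · intro k hk
        rw [Finset.mem_Ico] at hk
        rw [Finset.mem_filter, Finset.mem_range]
        exact ⟨by have := j.2; omega, h, hk.1, hk.2⟩
      · intros; positivity
    · apply Finset.sum_nonneg; intros; split_ifs <;> positivity
  refine h1.trans ?_
  rw [show (∑ i : Fin (M+1), ∑ j : Fin (M+1), ∑ k ∈ Finset.range M,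
      if P i j ∧ i.1 ≤ k ∧ k < j.1 then |F (k+1) - F k| else 0)
      = ∑ k ∈ Finset.range M, ∑ q : Fin (M+1) × Fin (M+1),
      if P q.1 q.2 ∧ q.1.1 ≤ k ∧ k < q.2.1 then |F (k+1) - F k| else 0 from by
        rw [Finset.sum_comm (s := Finset.range M), Fintype.sum_prod_type]]
  unfold tv
  refine Finset.sum_le_sum fun k _ => ?_
  rw [← Finset.sum_filter, Finset.sum_const, nsmul_eq_mul]
  have hc : (Finset.univ.filter fun q : Fin (M+1) × Fin (M+1) =>
      P q.1 q.2 ∧ q.1.1 ≤ k ∧ k < q.2.1).card ≤ 1 := by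
    rw [Finset.card_le_one]
    rintro ⟨i, j⟩ h ⟨i', j'⟩ h'
    simp only [Finset.mem_filter, Finset.mem_univ, true_and, P] at h h'
    obtain ⟨⟨a1, a2, a3, a4⟩, a5, a6⟩ := h
    obtain ⟨⟨b1, b2, b3, b4⟩, b5, b6⟩ := h'
    have e1 : i = i' := by
      rcases lt_trichotomy i i' with h | h | h
      · have := a4 i' h (by rw [Fin.lt_def]; omega)
        simp [this] at b1
      · exact h
      · have := b4 i h (by rw [Fin.lt_def]; omega)
        simp [this] at a1
    have e2 : j = j' := by
      rcases lt_trichotomy j j' with h | h | h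
      · have := b4 j (by rw [Fin.lt_def]; omega) h
        simp [this] at a2
      · exact h
      · have := a4 j' (by rw [Fin.lt_def]; omega) h
        simp [this] at b2
    rw [e1, e2]
  have hc' : ((Finset.univ.filter fun q : Fin (M+1) × Fin (M+1) =>
      P q.1 q.2 ∧ q.1.1 ≤ k ∧ k < q.2.1).card : ℝ) ≤ 1 := by exact_mod_cast hc
  nlinarith [abs_nonneg (F (k+1) - F k)]

structure SInv (H N m : ℕ) (av : ℕ → ℕ → Option ℕ) (F : ℕ → ℝ) (O : Set ℕ) : Prop where
  lo : ∀ j x p, j ≤ H → x * 2^j < N → av j x = some p → 1 ≤ p ∧ p + 2^j ≤ m + 1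
  disj : ∀ j x p j' x' p', j ≤ H → x * 2^j < N → av j x = some p →
    j' ≤ H → x' * 2^j' < N → av j' x' = some p' → (j ≠ j' ∨ x ≠ x') →
    p + 2^j ≤ p' ∨ p' + 2^j' ≤ p
  free : ∀ o ∈ O, ∀ j x p, j ≤ H → x * 2^j < N → av j x = some p → o < p ∨ p + 2^j ≤ o
  lab : ∀ j x p, j ≤ H → x * 2^j < N → av j x = some p →
    ∃ (d : ℝ) (y : ℕ), y / 2^j = x ∧ (y : ℝ) / N ≤ d ∧ d ≤ (y + 1 : ℝ) / N ∧
      ∀ i, p ≤ i → i < p + 2^j → F i = d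

lemma upd_cases {av : ℕ → ℕ → Option ℕ} {x j y q : ℕ} (hq : upd av x j y = some q) :
    (y = x / 2^j ∧ j < hsel av x ∧ q = psel av x + 2^j) ∨
    ((j ≠ hsel av x ∨ y ≠ x / 2^(hsel av x)) ∧ av j y = some q) := by
  unfold upd at hq
  split_ifs at hq with h1 h2 h3
  · left; exact ⟨h1, h2, by simpa using hq.symm⟩
  · right; exact ⟨Or.inl h3, hq⟩
  · right
    refine ⟨?_, hq⟩
    by_cases h : j = hsel av x
    · right; rw [← h]; exact h1
    · exact Or.inl h

lemma SInv.step {H N m : ℕ} {av : ℕ → ℕ → Option ℕ} {F : ℕ → ℝ} {O : Set ℕ}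
    (I : SInv H N m av F O) (x : ℕ) (hx : x < N) (v : ℝ) (hv1 : (x : ℝ) / N ≤ v)
    (hv2 : v ≤ (x + 1 : ℝ) / N) (hne : av (hsel av x) (x / 2^(hsel av x)) ≠ none)
    (hH : hsel av x ≤ H) (F' : ℕ → ℝ)
    (hF' : F' = fun i => if psel av x ≤ i ∧ i < psel av x + 2^(hsel av x) then v else F i) :
    SInv H N m (upd av x) F' (insert (psel av x) O) ∧
    1 ≤ psel av x ∧ psel av x ≤ m ∧ psel av x ∉ O ∧ (∀ o ∈ O, F' o = F o) ∧
    F' (psel av x) = v ∧ F' 0 = F 0 ∧ F' (m+1) = F (m+1) ∧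
    tv (m+1) F' ≤ tv (m+1) F + 2 * (2^(hsel av x) / N) := by
  set h := hsel av x with hh
  set p := psel av x with hp
  have hsome : av h (x / 2^h) = some p := by
    obtain ⟨q, hq⟩ := Option.ne_none_iff_exists'.mp hne
    rw [hp, psel, ← hh, hq]; rfl
  have hval : ∀ j, x / 2^j * 2^j < N := fun j => (Nat.div_mul_le_self x _).trans_lt hx
  have hlo := I.lo h _ p hH (hval h) hsome
  have h2 : 0 < 2^h := by positivity
  have pw : ∀ j, j < h → 2^j + 2^j ≤ 2^h := by
    intro j hj
    calc 2^j + 2^j = 2^(j+1) := by ring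
      _ ≤ 2^h := Nat.pow_le_pow_right (by norm_num) hj
  have pos : ∀ j : ℕ, 0 < 2^j := fun j => by positivity
  have hN : (0:ℝ) < N := by exact_mod_cast (by omega : 0 < N)
  have Fin' : ∀ i, p ≤ i → i < p + 2^h → F' i = v := by
    intro i a b; rw [hF']; simp [a, b]
  have Fout : ∀ i, (i < p ∨ p + 2^h ≤ i) → F' i = F i := by
    intro i a; rw [hF']; simp only; rw [if_neg (by omega)]
  refine ⟨⟨?_, ?_, ?_, ?_⟩, hlo.1, by omega, ?_, ?_, Fin' p le_rfl (by omega),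
    Fout 0 (by omega), Fout (m+1) (by omega), ?_⟩
  · intro j y q hj hy hq
    rcases upd_cases hq with ⟨_, b, c⟩ | ⟨_, b⟩
    · rw [← hh] at b; rw [← hp] at c
      have := pw j b
      have := pos j
      omega
    · exact I.lo j y q hj hy b
  · intro j y q j' y' q' hj hy hq hj' hy' hq' hd
    rcases upd_cases hq with ⟨a, b, c⟩ | ⟨a, b⟩ <;>
    rcases upd_cases hq' with ⟨a', b', c'⟩ | ⟨a', b'⟩
    · rw [← hp] at c c'
      have hjj : j ≠ j' := by
        rintro rfl
        rcases hd with hd | hd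
        · exact hd rfl
        · exact hd (a.trans a'.symm)
      rcases lt_or_gt_of_ne hjj with k | k
      · left
        have : 2^j + 2^j ≤ 2^j' := by
          calc 2^j + 2^j = 2^(j+1) := by ring
            _ ≤ 2^j' := Nat.pow_le_pow_right (by norm_num) k
        omega
      · right
        have : 2^j' + 2^j' ≤ 2^j := by
          calc 2^j' + 2^j' = 2^(j'+1) := by ring
            _ ≤ 2^j := Nat.pow_le_pow_right (by norm_num) k
        omega
    · rw [← hp] at c; rw [← hh] at b
      have := pw j b
      have := pos j
      have := I.disj j' y' q' h _ p hj' hy' b' hH (hval h) hsome a'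
      omega
    · rw [← hp] at c'; rw [← hh] at b'
      have := pw j' b'
      have := pos j'
      have := I.disj j y q h _ p hj hy b hH (hval h) hsome a
      omega
    · exact I.disj j y q j' y' q' hj hy b hj' hy' b' hd
  · intro o ho j y q hj hy hq
    rcases upd_cases hq with ⟨a, b, c⟩ | ⟨a, b⟩
    · rw [← hh] at b; rw [← hp] at c
      have := pw j b
      have := pos j
      have := pos j
      rcases ho with rfl | ho
      · omega
      · have := I.free o ho h _ p hH (hval h) hsome
        omega
    · rcases ho with rfl | ho
      · have := I.disj j y q h _ p hj hy b hH (hval h) hsome a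
        omega
      · exact I.free o ho j y q hj hy b
  · intro j y q hj hy hq
    rcases upd_cases hq with ⟨a, b, c⟩ | ⟨a, b⟩
    · rw [← hh] at b; rw [← hp] at c
      have := pw j b
      have := pos j
      refine ⟨v, x, a.symm, hv1, hv2, fun i i1 i2 => Fin' i (by omega) (by omega)⟩
    · obtain ⟨d, y', e1, e2, e3, e4⟩ := I.lab j y q hj hy b
      refine ⟨d, y', e1, e2, e3, fun i i1 i2 => ?_⟩
      have := I.disj j y q h _ p hj hy b hH (hval h) hsome a
      rw [Fout i (by omega)]
      exact e4 i i1 i2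
  · intro ho
    have := I.free p ho h _ p hH (hval h) hsome
    omega
  · intro o ho
    have := I.free o ho h _ p hH (hval h) hsome
    exact Fout o this
  · obtain ⟨d, y, e1, e2, e3, e4⟩ := I.lab h _ p hH (hval h) hsome
    have := tv_upd (m+1) F p (2^h) v d e4
    rw [← hF'] at this
    refine this.trans ?_
    have hb : |v - d| ≤ 2^h / N := by
      have hx1 : x < (x / 2^h) * 2^h + 2^h := by
        have := Nat.div_add_mod x (2^h); have := Nat.mod_lt x h2
        rw [mul_comm]; omega
      have hy1 : y < (x / 2^h) * 2^h + 2^h := by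
        have := Nat.div_add_mod y (2^h); have := Nat.mod_lt y h2
        rw [e1] at *
        rw [mul_comm]; omega
      have hx0 := Nat.div_mul_le_self x (2^h)
      have hy0 := Nat.div_mul_le_self y (2^h)
      rw [e1] at hy0
      have k1 : x + 1 ≤ y + 2^h := by omega
      have k2 : y + 1 ≤ x + 2^h := by omega
      have k1' : (x + 1 : ℝ) ≤ y + 2^h := by exact_mod_cast k1
      have k2' : (y + 1 : ℝ) ≤ x + 2^h := by exact_mod_cast k2
      have l1 : (x + 1 : ℝ) / N ≤ y / N + 2^h / N := by
        rw [← add_div]; gcongr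
      have l2 : (y + 1 : ℝ) / N ≤ x / N + 2^h / N := by
        rw [← add_div]; gcongr
      rw [abs_le]; constructor <;> linarith
    linarith

lemma sel_none {av : ℕ → ℕ → Option ℕ} {x j : ℕ} (hj : j < hsel av x) :
    av j (x / 2^j) = none := by
  by_contra h
  exact absurd (Nat.sInf_le (s := {j | av j (x / 2^j) ≠ none}) h) (by unfold hsel at hj; omega)

lemma sel_ne {av : ℕ → ℕ → Option ℕ} {x j : ℕ} (hj : av j (x / 2^j) ≠ none) :
    av (hsel av x) (x / 2^(hsel av x)) ≠ none ∧ hsel av x ≤ j :=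
  ⟨Nat.sInf_mem (s := {j | av j (x / 2^j) ≠ none}) ⟨j, hj⟩, Nat.sInf_le hj⟩

def cN (H : ℕ) (x : ℕ → ℕ) (j t : ℕ) : ℕ :=
  ∑ s ∈ Finset.range t, if j ≤ hsel (stt H x s) (x s) then 1 else 0

def cD (N : ℕ) (av : ℕ → ℕ → Option ℕ) (j : ℕ) : ℕ :=
  ((Finset.range N).filter fun y => av j y = none).card

lemma cD_upd {N : ℕ} {av : ℕ → ℕ → Option ℕ} {x : ℕ} (hx : x < N)
    (hne : av (hsel av x) (x / 2^(hsel av x)) ≠ none) (j : ℕ) :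
    cD N (upd av x) j + (if j + 1 ≤ hsel av x then 1 else 0) +
      (if j + 1 ≤ hsel av x then 1 else 0) =
    cD N av j + (if j ≤ hsel av x then 1 else 0) := by
  have hmem : x / 2^j ∈ Finset.range N :=
    Finset.mem_range.mpr ((Nat.div_le_self _ _).trans_lt hx)
  unfold cD
  rcases lt_trichotomy j (hsel av x) with h | h | h
  · rw [if_pos (by omega), if_pos (by omega)]
    have h1 : ((Finset.range N).filter fun y => upd av x j y = none) =
        ((Finset.range N).filter fun y => av j y = none).erase (x / 2^j) := by
      ext y
      simp only [Finset.mem_filter, Finset.mem_erase, upd, h, if_true]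
      by_cases hy : y = x / 2^j <;> simp [hy]
    rw [h1, Finset.card_erase_of_mem (by simp [sel_none h, -Finset.mem_range, hmem])]
    have : 0 < ((Finset.range N).filter fun y => av j y = none).card :=
      Finset.card_pos.mpr ⟨x / 2^j, by simp [sel_none h, -Finset.mem_range, hmem]⟩
    omega
  · rw [if_neg (by omega), if_pos (by omega)]
    have h1 : ((Finset.range N).filter fun y => upd av x j y = none) =
        insert (x / 2^j) ((Finset.range N).filter fun y => av j y = none) := by
      ext y
      rw [Finset.mem_insert, Finset.mem_filter, Finset.mem_filter, upd]
      by_cases hy : y = x / 2^j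
      · simp only [hy, ← h, lt_irrefl, if_true, if_false, hmem, true_and, true_or]
      · simp [hy]
    rw [h1, Finset.card_insert_of_notMem]
    rw [← h] at hne
    simp [hne]
  · rw [if_neg (by omega), if_neg (by omega)]
    have h1 : ((Finset.range N).filter fun y => upd av x j y = none) =
        ((Finset.range N).filter fun y => av j y = none) := by
      ext y
      simp only [Finset.mem_filter, upd, not_lt.mpr h.le, h.ne', if_false, ite_self]
    rw [h1]

lemma cN_bound {H N : ℕ} {x : ℕ → ℕ} {t : ℕ}
    (hc : ∀ j, cD N (stt H x t) j + cN H x (j+1) t + cN H x (j+1) t = cN H x j t) (j : ℕ) :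
    2^j * cN H x j t ≤ t := by
  induction j with
  | zero => simp [cN]
  | succ j ih =>
    have := hc j
    have h : 2^(j+1) * cN H x (j+1) t = 2^j * (cN H x (j+1) t + cN H x (j+1) t) := by ring
    rw [h]
    exact (Nat.mul_le_mul_left _ (by omega)).trans ih

lemma count_inv {H N n : ℕ} {x : ℕ → ℕ} (hx : ∀ t, x t < N) (hn : n < 2^H) (t : ℕ) (ht : t ≤ n) :
    (∀ j, cD N (stt H x t) j + cN H x (j+1) t + cN H x (j+1) t = cN H x j t) ∧
    (stt H x t H (x t / 2^H) ≠ none) := by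
  induction t with
  | zero =>
    refine ⟨fun j => ?_, by simp [stt, av0]⟩
    simp [cN, cD, stt, av0]
  | succ t ih =>
    obtain ⟨h1, h2⟩ := ih (by omega)
    have hc : ∀ j, cD N (stt H x (t+1)) j + cN H x (j+1) (t+1) + cN H x (j+1) (t+1)
        = cN H x j (t+1) := by
      intro j
      have a := cD_upd (hx t) (sel_ne h2).1 j
      have b := h1 j
      unfold cN at b ⊢
      rw [Finset.sum_range_succ, Finset.sum_range_succ]
      change cD N (upd (stt H x t) (x t)) j + _ + _ = _
      omega
    refine ⟨hc, fun h => ?_⟩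
    have b := cN_bound hc H
    have hz : cN H x H (t+1) = 0 := by
      by_contra h0
      have : 2^H * 1 ≤ 2^H * cN H x H (t+1) := Nat.mul_le_mul_left _ (by omega)
      omega
    have hD := hc H
    have hD0 : cD N (stt H x (t+1)) H = 0 := by omega
    rw [cD, Finset.card_eq_zero] at hD0
    have : x (t+1) / 2^H ∈ (Finset.range N).filter fun y => stt H x (t+1) H y = none := by
      rw [Finset.mem_filter, Finset.mem_range]
      exact ⟨(Nat.div_le_self _ _).trans_lt (hx _), h⟩
    rw [hD0] at this
    simp at this

lemma sum_pow_le {H N n : ℕ} {x : ℕ → ℕ} (hx : ∀ t, x t < N) (hn : n < 2^H) :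
    ∑ t ∈ Finset.range n, 2^(hsel (stt H x t) (x t)) ≤ (H+1) * n := by
  calc ∑ t ∈ Finset.range n, 2^(hsel (stt H x t) (x t))
      ≤ ∑ t ∈ Finset.range n, ∑ j ∈ Finset.range (H+1),
        2^j * (if j ≤ hsel (stt H x t) (x t) then 1 else 0) := by
        refine Finset.sum_le_sum fun t ht => ?_
        rw [Finset.mem_range] at ht
        have h2 := (sel_ne (count_inv hx hn t ht.le).2).2
        refine le_trans ?_ (Finset.single_le_sum (f := fun j => 2^j *
          (if j ≤ hsel (stt H x t) (x t) then 1 else 0)) (fun _ _ => Nat.zero_le _)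
          (Finset.mem_range.mpr (by omega : hsel (stt H x t) (x t) < H + 1)))
        simp
    _ = ∑ j ∈ Finset.range (H+1), 2^j * cN H x j n := by
        rw [Finset.sum_comm]
        simp only [cN, Finset.mul_sum]
    _ ≤ ∑ j ∈ Finset.range (H+1), n :=
        Finset.sum_le_sum fun j _ => cN_bound (count_inv hx hn n le_rfl).1 j
    _ = _ := by simp

lemma bs_succ (H x : ℕ) : bs H (x+1) = bs H x + bsz H x := by
  unfold bs; rw [Finset.sum_range_succ]; ring

lemma bs_mono (H : ℕ) : Monotone (bs H) :=
  monotone_nat_of_le_succ fun x => by rw [bs_succ]; omega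

lemma bs_zero (H : ℕ) : bs H 0 = 1 := by simp [bs]

lemma geo (j : ℕ) : ∑ i ∈ Finset.range (j+1), 2^i + 1 = 2^j + 2^j := by
  induction j with
  | zero => simp
  | succ j ih => rw [Finset.sum_range_succ]; rw [pow_succ]; omega

lemma bsz_ge {H j y : ℕ} (hj : j ≤ H) (hd : 2^j ∣ y) : 2^j + 2^j ≤ bsz H y + 1 := by
  rw [← geo]
  unfold bsz
  have : ∑ i ∈ Finset.range (j+1), 2^i =
      ∑ i ∈ Finset.range (j+1), if 2^i ∣ y then 2^i else 0 := by
    refine Finset.sum_congr rfl fun i hi => ?_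
    rw [Finset.mem_range] at hi
    rw [if_pos ((pow_dvd_pow 2 (by omega)).trans hd)]
  rw [this]
  gcongr

lemma bs_lt_succ (H x : ℕ) : bs H x < bs H (x+1) := by
  have := bsz_ge (Nat.zero_le H) (by simp : 2^0 ∣ x)
  rw [bs_succ]; simp at this; omega

lemma bs_strict (H : ℕ) : StrictMono (bs H) := strictMono_nat_of_lt_succ (bs_lt_succ H)

lemma own_bd {H j x : ℕ} (hj : j ≤ H) :
    bs H (x * 2^j) ≤ own H j x ∧ own H j x + 2^j ≤ bs H (x * 2^j + 1) := by
  have := bsz_ge hj (Dvd.intro_left x rfl : 2^j ∣ x * 2^j)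
  have : 0 < 2^j := by positivity
  rw [bs_succ]; unfold own; omega

lemma bs_upper (H N : ℕ) : bs H N ≤ 1 + (H+1) * N + (2^H + 2^H) := by
  unfold bs bsz
  rw [Finset.sum_comm]
  have : ∀ j ∈ Finset.range (H+1), (∑ y ∈ Finset.range N, if 2^j ∣ y then 2^j else 0)
      ≤ N + 2^j := by
    intro j _
    induction N using Nat.strong_induction_on with
    | _ N ih =>
      have pj : 0 < 2^j := by positivity
      by_cases hN : N ≤ 2^j
      · rw [← Finset.sum_filter, Finset.sum_const, smul_eq_mul]
        have : ((Finset.range N).filter fun y => 2^j ∣ y).card ≤ 1 := by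
          rw [Finset.card_le_one]
          intro a ha b hb
          simp only [Finset.mem_filter, Finset.mem_range] at ha hb
          rw [Nat.eq_zero_of_dvd_of_lt ha.2 (by omega), Nat.eq_zero_of_dvd_of_lt hb.2 (by omega)]
        nlinarith
      · obtain ⟨k, rfl⟩ : ∃ k, N = 2^j + k := ⟨N - 2^j, by omega⟩
        rw [Finset.sum_range_add]
        have a := ih k (by omega)
        have e : ∑ y ∈ Finset.range k, (if 2^j ∣ 2^j + y then 2^j else 0)
            = ∑ y ∈ Finset.range k, (if 2^j ∣ y then 2^j else 0) := by
          refine Finset.sum_congr rfl fun y _ => ?_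
          simp only [Nat.dvd_add_right (dvd_refl (2^j))]
        have b : ∑ y ∈ Finset.range (2^j), (if 2^j ∣ y then 2^j else 0) ≤ 2^j := by
          rw [← Finset.sum_filter, Finset.sum_const, smul_eq_mul]
          have : ((Finset.range (2^j)).filter fun y => 2^j ∣ y).card ≤ 1 := by
            rw [Finset.card_le_one]
            intro a ha b hb
            simp only [Finset.mem_filter, Finset.mem_range] at ha hb
            rw [Nat.eq_zero_of_dvd_of_lt ha.2 (by omega), Nat.eq_zero_of_dvd_of_lt hb.2 (by omega)]
          nlinarith
        rw [e]; omega
  have h2 := Finset.sum_le_sum this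
  rw [Finset.sum_add_distrib] at h2
  have := geo H
  simp only [Finset.sum_const, Finset.card_range, smul_eq_mul] at h2
  omega

def F0 (H N : ℕ) (i : ℕ) : ℝ :=
  (((Finset.Icc 1 N).filter fun y => bs H y ≤ i).card : ℝ) / N

lemma F0_mono (H N : ℕ) : Monotone (F0 H N) := by
  intro i k h
  unfold F0
  gcongr

lemma F0_zero (H N : ℕ) : F0 H N 0 = 0 := by
  unfold F0
  have : ((Finset.Icc 1 N).filter fun y => bs H y ≤ 0) = ∅ := by
    apply Finset.filter_eq_empty_iff.mpr
    intro y _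
    unfold bs; omega
  rw [this]; simp

lemma F0_last {H N : ℕ} (hN : 0 < N) : F0 H N (bs H N) = 1 := by
  unfold F0
  have : ((Finset.Icc 1 N).filter fun y => bs H y ≤ bs H N) = Finset.Icc 1 N := by
    apply Finset.filter_true_of_mem
    intro y hy
    exact bs_mono H (Finset.mem_Icc.mp hy).2
  rw [this]
  have : (N : ℝ) ≠ 0 := by positivity
  simp [this]

lemma F0_block {H N y i : ℕ} (hy : y < N) (h1 : bs H y ≤ i) (h2 : i < bs H (y+1)) :
    F0 H N i = y / N := by
  unfold F0
  have : ((Finset.Icc 1 N).filter fun y => bs H y ≤ i) = Finset.Icc 1 y := by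
    ext z
    simp only [Finset.mem_filter, Finset.mem_Icc]
    constructor
    · rintro ⟨⟨a, b⟩, c⟩
      refine ⟨a, ?_⟩
      by_contra h
      have := bs_mono H (by omega : y + 1 ≤ z)
      omega
    · rintro ⟨a, b⟩
      exact ⟨⟨a, by omega⟩, (bs_mono H b).trans h1⟩
  rw [this]; simp

lemma tv_mono {M : ℕ} {F : ℕ → ℝ} (hF : Monotone F) : tv M F = F M - F 0 := by
  unfold tv
  rw [← Finset.sum_range_sub]
  refine Finset.sum_congr rfl fun i _ => ?_
  rw [abs_of_nonneg]
  have := hF (Nat.le_succ i)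
  simp at this ⊢; linarith

lemma SInv_zero {H N m : ℕ} (hm : m + 1 = bs H N) :
    SInv H N m (av0 H) (F0 H N) ∅ := by
  have lb : ∀ x, 1 ≤ bs H x := fun x => by unfold bs; omega
  refine ⟨?_, ?_, ?_, ?_⟩
  · intro j x p hj hx hp
    simp only [av0, Option.some.injEq] at hp
    have := own_bd (x := x) hj
    have := bs_mono H (by omega : x * 2^j + 1 ≤ N)
    have := lb (x * 2^j)
    omega
  · intro j x p j' x' p' hj hx hp hj' hx' hp' hd
    simp only [av0, Option.some.injEq] at hp hp'
    have a := own_bd (x := x) hj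
    have a' := own_bd (x := x') hj'
    rcases lt_trichotomy (x * 2^j) (x' * 2^j') with h | h | h
    · have := bs_mono H (by omega : x * 2^j + 1 ≤ x' * 2^j')
      omega
    · have hjj : j ≠ j' := by
        rintro rfl
        rcases hd with hd | hd
        · exact hd rfl
        · exact hd (Nat.eq_of_mul_eq_mul_right (by positivity) h)
      unfold own at hp hp'
      rw [h] at hp
      have q1 : 0 < 2^j := by positivity
      have q2 : 0 < 2^j' := by positivity
      rcases lt_or_gt_of_ne hjj with k | k
      · left
        have : 2^j + 2^j ≤ 2^j' := by
          calc 2^j + 2^j = 2^(j+1) := by ring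
            _ ≤ 2^j' := Nat.pow_le_pow_right (by norm_num) k
        omega
      · right
        have : 2^j' + 2^j' ≤ 2^j := by
          calc 2^j' + 2^j' = 2^(j'+1) := by ring
            _ ≤ 2^j := Nat.pow_le_pow_right (by norm_num) k
        omega
    · have := bs_mono H (by omega : x' * 2^j' + 1 ≤ x * 2^j)
      omega
  · intro o ho; exact absurd ho (Set.notMem_empty o)
  · intro j x p hj hx hp
    simp only [av0, Option.some.injEq] at hp
    have a := own_bd (x := x) hj
    refine ⟨((x * 2^j : ℕ) : ℝ) / N, x * 2^j, Nat.mul_div_cancel _ (by positivity), le_rfl,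
      by gcongr; linarith, fun i i1 i2 => F0_block hx (by omega) (by omega)⟩

/-- The main simulation. -/
lemma sim {H N n m : ℕ} {x : ℕ → ℕ} {v : ℕ → ℝ} (hN : 0 < N) (hm : m + 1 = bs H N)
    (hx : ∀ t, x t < N) (hn : n < 2^H)
    (hv1 : ∀ t, (x t : ℝ) / N ≤ v t) (hv2 : ∀ t, v t ≤ (x t + 1 : ℝ) / N) (t : ℕ) (ht : t ≤ n) :
    ∃ F : ℕ → ℝ, SInv H N m (stt H x t) F {q | ∃ s < t, q = psel (stt H x s) (x s)} ∧
      (∀ s < t, 1 ≤ psel (stt H x s) (x s) ∧ psel (stt H x s) (x s) ≤ m ∧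
        F (psel (stt H x s) (x s)) = v s) ∧
      (∀ s < t, ∀ r < s, psel (stt H x s) (x s) ≠ psel (stt H x r) (x r)) ∧
      F 0 = 0 ∧ F (m+1) = 1 ∧
      tv (m+1) F ≤ 1 + 2 * ((∑ s ∈ Finset.range t, 2^(hsel (stt H x s) (x s)) : ℕ) : ℝ) / N := by
  induction t with
  | zero =>
    refine ⟨F0 H N, ?_, by simp, by simp, F0_zero H N, by rw [hm]; exact F0_last hN, ?_⟩
    · have := SInv_zero hm
      simpa [stt] using this
    · rw [tv_mono (F0_mono H N), hm, F0_last hN, F0_zero]; simp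
  | succ t ih =>
    obtain ⟨F, I, h1, h2, h3, h4, h5⟩ := ih (by omega)
    have hs := sel_ne (count_inv hx hn t (by omega)).2
    obtain ⟨J, k1, k2, k3, k4, k5, k6, k7, k8⟩ :=
      I.step (x t) (hx t) (v t) (hv1 t) (hv2 t) hs.1 hs.2 _ rfl
    set F' := fun i => if psel (stt H x t) (x t) ≤ i ∧
      i < psel (stt H x t) (x t) + 2^(hsel (stt H x t) (x t)) then v t else F i with hF'
    refine ⟨F', ?_, ?_, ?_, k6.trans h3, k7.trans h4, ?_⟩
    · have e : {q | ∃ s < t+1, q = psel (stt H x s) (x s)} =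
          insert (psel (stt H x t) (x t)) {q | ∃ s < t, q = psel (stt H x s) (x s)} := by
        ext q
        simp only [Set.mem_ofPred_eq, Set.mem_insert_iff]
        constructor
        · rintro ⟨s, a, b⟩
          rcases Nat.lt_succ_iff_lt_or_eq.mp a with c | c
          · exact Or.inr ⟨s, c, b⟩
          · subst c; exact Or.inl b
        · rintro (b | ⟨s, a, b⟩)
          · exact ⟨t, by omega, b⟩
          · exact ⟨s, by omega, b⟩
      rw [e]; exact J
    · intro s hs
      rcases Nat.lt_succ_iff_lt_or_eq.mp hs with c | c
      · have := h1 s c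
        exact ⟨this.1, this.2.1, (k4 _ ⟨s, c, rfl⟩).trans this.2.2⟩
      · subst c; exact ⟨k1, k2, k5⟩
    · intro s hs r hr
      rcases Nat.lt_succ_iff_lt_or_eq.mp hs with c | c
      · exact h2 s c r hr
      · subst c
        intro h
        exact k3 ⟨r, hr, h⟩
    · rw [Finset.sum_range_succ]
      refine (k8.trans (add_le_add_left h5 _)).trans (le_of_eq ?_)
      push_cast
      ring

def leafOf (N : ℕ) (v : ℝ) : ℕ := min ⌊v * N⌋₊ (N - 1)

lemma leafOf_lt {N : ℕ} (hN : 0 < N) (v : ℝ) : leafOf N v < N := by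
  unfold leafOf; omega

lemma leafOf_le {N : ℕ} (hN : 0 < N) {v : ℝ} (hv : v ∈ Set.Icc (0:ℝ) 1) :
    (leafOf N v : ℝ) / N ≤ v := by
  have hN' : (0:ℝ) < N := by exact_mod_cast hN
  rw [div_le_iff₀ hN']
  have h1 : (leafOf N v : ℝ) ≤ ⌊v * N⌋₊ := by
    exact_mod_cast (min_le_left _ _ : leafOf N v ≤ ⌊v * N⌋₊)
  exact h1.trans (Nat.floor_le (mul_nonneg hv.1 hN'.le))

lemma le_leafOf {N : ℕ} (hN : 0 < N) {v : ℝ} (hv : v ∈ Set.Icc (0:ℝ) 1) :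
    v ≤ (leafOf N v + 1 : ℝ) / N := by
  have hN' : (0:ℝ) < N := by exact_mod_cast hN
  rw [le_div_iff₀ hN']
  unfold leafOf
  rcases min_choice ⌊v * N⌋₊ (N - 1) with h | h
  · rw [h]; exact (Nat.lt_floor_add_one _).le
  · rw [h]
    have : ((N - 1 : ℕ) : ℝ) + 1 = N := by exact_mod_cast (by omega : N - 1 + 1 = N)
    rw [this]
    nlinarith [hv.2]

def mkStrat (H N m : ℕ) (hm : 0 < m) (l : List ℝ) : Fin m :=
  ⟨(psel (List.foldl upd (av0 H) (l.dropLast.map (leafOf N))) (leafOf N (l.getLast?.getD 0)) - 1) % m,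
    Nat.mod_lt _ hm⟩

lemma take_ofFn_succ {n : ℕ} (a : Fin n → ℝ) (t : ℕ) (ht : t < n) :
    (List.ofFn a).take (t+1) = (List.ofFn a).take t ++ [a ⟨t, ht⟩] := by
  rw [List.take_add_one]
  simp [ht]

def extA {n : ℕ} (a : Fin n → ℝ) (t : ℕ) : ℝ := if h : t < n then a ⟨t, h⟩ else 0

lemma foldl_stt {n : ℕ} (H N : ℕ) (a : Fin n → ℝ) (t : ℕ) (ht : t ≤ n) :
    List.foldl upd (av0 H) (((List.ofFn a).take t).map (leafOf N))
      = stt H (fun s => leafOf N (extA a s)) t := by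
  induction t with
  | zero => simp [stt]
  | succ t ih =>
    rw [take_ofFn_succ a t (by omega), List.map_append, List.foldl_append, ih (by omega)]
    simp [stt, extA, show t < n by omega]

lemma place_eq {n : ℕ} (H N m : ℕ) (hm : 0 < m) (a : Fin n → ℝ) (t : Fin n) :
    (place (mkStrat H N m hm) a t).1 =
      (psel (stt H (fun s => leafOf N (extA a s)) t.1) (leafOf N (extA a t.1)) - 1) % m := by
  unfold place mkStrat
  simp only
  rw [take_ofFn_succ a t.1 t.2, List.dropLast_concat, List.getLast?_concat,
    foldl_stt H N a t.1 t.2.le]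
  simp [extA]

lemma core_s1 {n H N m : ℕ} (hN : 0 < N) (hm0 : 0 < m) (hm : m + 1 = bs H N) (hn : n < 2^H)
    (a : Fin n → ℝ) (ha : ∀ t, a t ∈ Set.Icc (0 : ℝ) 1) :
    Function.Injective (place (mkStrat H N m hm0) a) ∧
      configCost (withSentinels a (place (mkStrat H N m hm0) a)) ≤
        1 + 2 * (((H+1) * n : ℕ) : ℝ) / N := by
  have hext : ∀ t, extA a t ∈ Set.Icc (0:ℝ) 1 := by
    intro t; unfold extA; split_ifs
    · exact ha _
    · simp
  have hx : ∀ t, leafOf N (extA a t) < N := fun t => leafOf_lt hN _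
  obtain ⟨F, I, h1, h2, h3, h4, h5⟩ := sim (x := fun s => leafOf N (extA a s)) (v := extA a)
    hN hm hx hn (fun t => leafOf_le hN (hext t)) (fun t => le_leafOf hN (hext t)) n le_rfl
  set x : ℕ → ℕ := fun s => leafOf N (extA a s) with hxd
  have hpl : ∀ t : Fin n, (place (mkStrat H N m hm0) a t).1 + 1 = psel (stt H x t.1) (x t.1) := by
    intro t
    rw [place_eq]
    have : 1 ≤ psel (stt H x t.1) (x t.1) ∧ psel (stt H x t.1) (x t.1) ≤ m :=
      ⟨(h1 t.1 t.2).1, (h1 t.1 t.2).2.1⟩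
    rw [Nat.mod_eq_of_lt]
    · change psel (stt H x t.1) (x t.1) - 1 + 1 = _
      omega
    · change psel (stt H x t.1) (x t.1) - 1 < m
      omega
  constructor
  · intro s t hst
    have e : psel (stt H x s.1) (x s.1) = psel (stt H x t.1) (x t.1) := by
      rw [← hpl, ← hpl, hst]
    rcases lt_trichotomy s.1 t.1 with h | h | h
    · exact absurd e.symm (h2 t.1 t.2 s.1 h)
    · exact Fin.ext h
    · exact absurd e (h2 s.1 s.2 t.1 h)
  · refine (configCost_le_tv (m+1) _ F ?_).trans (h5.trans ?_)
    · intro i hi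
      unfold withSentinels at hi ⊢
      split_ifs at hi ⊢ with c1 c2 c3
      · rw [c1, h3]; rfl
      · rw [c2, h4]; rfl
      · have := c3.choose_spec
        have e := (h1 _ c3.choose.2).2.2
        have e2 := hpl c3.choose
        rw [this] at e2
        change a c3.choose = F i.1
        refine Eq.trans ?_ (e.symm.trans (congrArg F e2.symm))
        simp [extA]
      · simp at hi
    · have := sum_pow_le (H := H) (N := N) (n := n) (x := x) hx hn
      gcongr

theorem statement1 :
    ∃ C C₁ : ℝ, 0 < C ∧ 1 ≤ C₁ ∧
      ∀ n : ℕ, 2 ≤ n → ∀ γ : ℝ, C₁ ≤ γ → γ ≤ (Real.logb 2 n) ^ 2 →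
        ∃ m : ℕ, (m : ℝ) ≤ C * γ * n ∧
          ∃ strat : List ℝ → Fin m,
            ∀ a : Fin n → ℝ, (∀ t, a t ∈ Set.Icc (0 : ℝ) 1) →
              Function.Injective (place strat a) ∧
              configCost (withSentinels a (place strat a)) ≤
                C * (Real.logb 2 n) ^ 2 / γ := by
  refine ⟨10, 1, by norm_num, le_rfl, ?_⟩
  intro n hn γ hγ1 hγ2
  set L := Real.logb 2 n with hL
  have hn' : (2:ℝ) ≤ n := by exact_mod_cast hn
  have hL1 : 1 ≤ L := by
    rw [hL, Real.le_logb_iff_rpow_le (by norm_num) (by linarith)]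
    simpa using hn'
  have hLn : L ≤ n := by
    rw [hL, Real.logb_le_iff_le_rpow (by norm_num) (by linarith)]
    rw [Real.rpow_natCast]
    exact_mod_cast (Nat.lt_two_pow_self (n := n)).le
  set k := Nat.log 2 n with hk
  have hkL : (k : ℝ) ≤ L := by
    rw [hL, Real.le_logb_iff_rpow_le (by norm_num) (by linarith), Real.rpow_natCast]
    exact_mod_cast Nat.pow_log_le_self 2 (by omega : n ≠ 0)
  have hk1 : 2^k ≤ n := Nat.pow_log_le_self 2 (by omega)
  have hk2 : n < 2^(k+1) := Nat.lt_pow_succ_log_self (by norm_num) n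
  set r : ℝ := γ * n / L with hr
  have hr1 : 1 ≤ r := by
    rw [hr, le_div_iff₀ (by linarith)]
    nlinarith
  set N := ⌈r⌉₊ with hNd
  have hN1 : r ≤ N := Nat.le_ceil r
  have hN2 : (N : ℝ) ≤ 2 * r := by
    have := Nat.ceil_lt_add_one (by linarith : 0 ≤ r)
    linarith
  have hNpos : 0 < N := Nat.ceil_pos.mpr (by linarith)
  have hb := bs_upper (k+1) N
  have hb2 : 1 < bs (k+1) N := by
    have := bs_strict (k+1) hNpos
    rw [bs_zero] at this
    exact this
  obtain ⟨m, hm⟩ : ∃ m, m + 1 = bs (k+1) N := ⟨bs (k+1) N - 1, by omega⟩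
  have hm0 : 0 < m := by omega
  have hLr : L * r = γ * n := by rw [hr]; field_simp
  refine ⟨m, ?_, mkStrat (k+1) N m hm0, ?_⟩
  · have h1 : m ≤ (k+1+1) * N + 4 * n := by
      have : 2^(k+1) = 2 * 2^k := by ring
      omega
    have h2 : (m : ℝ) ≤ (k+1+1) * N + 4 * n := by exact_mod_cast h1
    have h3 : ((k:ℝ)+1+1) * N ≤ (3 * L) * (2 * r) := by
      apply mul_le_mul (by linarith) hN2 (by positivity) (by linarith)
    nlinarith
  · intro a ha
    obtain ⟨c1, c2⟩ := core_s1 hNpos hm0 hm hk2 a ha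
    refine ⟨c1, c2.trans ?_⟩
    have e1 : 1 ≤ L^2 / γ := by
      rw [le_div_iff₀ (by linarith)]; linarith
    have e2 : 2 * (((k+1+1) * n : ℕ) : ℝ) / N ≤ 6 * (L^2 / γ) := by
      rw [div_le_iff₀ (by exact_mod_cast hNpos)]
      push_cast
      have e3 : 6 * (L^2 / γ) * r = 6 * L * n := by
        rw [hr]; field_simp
      have e4 : 6 * (L^2 / γ) * r ≤ 6 * (L^2/γ) * N := by gcongr
      nlinarith
    have : 10 * L^2 / γ = 10 * (L^2/γ) := by ring
    linarith
end
end

section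
/- There is an absolute constant C such that for every integer n ≥ 2 there is a deterministic online sorting algorithm with known range that uses an array with at most C·n·(log₂ n)² middle cells and has cost at most C on every sequence of n elements of [0,1]. -/
/-!
Online sorting with known range (see stmt_0 for the model).

STATEMENT 2: there is an absolute constant `C` such that for every `n ≥ 2` there is a
deterministic online algorithm using at most `C n (log₂ n)²` middle cells whose cost is at
most `C` on every input of `n` elements of `[0,1]`.
-/

noncomputable section
attribute [local instance] Classical.propDecidable

def rk (T : Finset ℕ) (β : ℕ → ℕ) (t : ℕ) : ℕ :=
  (T.filter (fun s => s < t ∧ β s = β t)).card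

def nxt (T : Finset ℕ) (β : ℕ → ℕ) : Finset ℕ :=
  T.filter (fun t => 2 ≤ rk T β t ∧ rk T β t % 2 = 0)

def par (T : Finset ℕ) (β : ℕ → ℕ) (t : ℕ) : ℕ :=
  if rk T β t % 2 = 0 then t else
    Classical.epsilon (fun s => s < t ∧ s ∈ T ∧ β s = β t ∧ rk T β s + 1 = rk T β t)

def cell : ℕ → Finset ℕ → (ℕ → ℕ) → ℕ → ℕ ×ₗ ℕ
  | 0, T, β, t => toLex (2 * β t + 1, rk T β t + 1)
  | d + 1, T, β, t =>
    if rk T β t < 2 then toLex (2 * β t + 1, rk T β t + 1)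
    else toLex (2 * (ofLex (cell d (nxt T β) (fun s => β s / 2) (par T β t))).1,
      2 * (ofLex (cell d (nxt T β) (fun s => β s / 2) (par T β t))).2 - 1 + rk T β t % 2)

theorem rk_lt {T : Finset ℕ} {β : ℕ → ℕ} {s t : ℕ} (hs : s ∈ T) (hst : s < t)
    (hb : β s = β t) : rk T β s < rk T β t := by
  unfold rk
  apply Finset.card_lt_card
  rw [Finset.ssubset_iff_of_subset]
  · exact ⟨s, by simp [hs, hst, hb], by simp⟩
  · intro x hx
    simp only [Finset.mem_filter] at hx ⊢
    exact ⟨hx.1, hx.2.1.trans hst, hx.2.2.trans hb⟩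

theorem rk_inj {T : Finset ℕ} {β : ℕ → ℕ} {s t : ℕ} (hs : s ∈ T) (ht : t ∈ T)
    (hb : β s = β t) (h : rk T β s = rk T β t) : s = t := by
  rcases lt_trichotomy s t with h1 | h1 | h1
  · have := rk_lt hs h1 hb
    omega
  · exact h1
  · have := rk_lt ht h1 hb.symm
    omega

theorem rk_pred {T : Finset ℕ} {β : ℕ → ℕ} {t : ℕ} (h : 0 < rk T β t) :
    ∃ s, s < t ∧ s ∈ T ∧ β s = β t ∧ rk T β s + 1 = rk T β t := by
  unfold rk at h
  have hne := Finset.card_pos.mp h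
  obtain ⟨s, hs, hmax⟩ := Finset.exists_max_image _ (fun x => x) hne
  have hs' := hs
  simp only [Finset.mem_filter] at hs'
  refine ⟨s, hs'.2.1, hs'.1, hs'.2.2, ?_⟩
  have : T.filter (fun x => x < t ∧ β x = β t)
      = insert s (T.filter (fun x => x < s ∧ β x = β s)) := by
    ext x
    constructor
    · intro hx
      have h1 := hmax x hx
      simp only [Finset.mem_filter, Finset.mem_insert] at hx ⊢
      rcases eq_or_lt_of_le h1 with h2 | h2
      · exact Or.inl h2
      · exact Or.inr ⟨hx.1, h2, hx.2.2.trans hs'.2.2.symm⟩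
    · intro hx
      simp only [Finset.mem_filter, Finset.mem_insert] at hx ⊢
      rcases hx with h2 | h2
      · subst h2
        exact hs'
      · exact ⟨h2.1, h2.2.1.trans hs'.2.1, h2.2.2.trans hs'.2.2⟩
  unfold rk
  rw [this, Finset.card_insert_of_notMem (by simp)]

theorem par_spec {T : Finset ℕ} {β : ℕ → ℕ} {t : ℕ} (ht : t ∈ T) (h : 2 ≤ rk T β t) :
    par T β t ∈ nxt T β ∧ par T β t ≤ t ∧ β (par T β t) = β t ∧
      rk T β (par T β t) + rk T β t % 2 = rk T β t := by
  unfold par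
  split_ifs with h0
  · exact ⟨by simp [nxt, ht, h, h0], le_rfl, rfl, by omega⟩
  · have := Classical.epsilon_spec (rk_pred (T := T) (β := β) (t := t) (by omega))
    obtain ⟨h1, h2, h3, h4⟩ := this
    refine ⟨?_, h1.le, h3, by omega⟩
    simp only [nxt, Finset.mem_filter]
    exact ⟨h2, by omega, by omega⟩

theorem card_nxt (T : Finset ℕ) (β : ℕ → ℕ) : 2 * (nxt T β).card ≤ T.card := by
  have hp : ∀ t ∈ nxt T β, ∃ s, s < t ∧ s ∈ T ∧ β s = β t ∧ rk T β s + 1 = rk T β t := by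
    intro t ht
    simp only [nxt, Finset.mem_filter] at ht
    exact rk_pred (by omega)
  choose! f hf using hp
  have hsub : nxt T β ⊆ T := Finset.filter_subset _ _
  have h1 : (nxt T β).card ≤ (T \ nxt T β).card := by
    apply Finset.card_le_card_of_injOn f
    · intro t ht
      have h := hf t ht
      have ht' := ht
      simp only [nxt, Finset.coe_filter, Set.mem_ofPred_eq] at ht'
      simp only [Finset.coe_sdiff, Set.mem_sdiff, Finset.mem_coe]
      refine ⟨h.2.1, fun hc => ?_⟩
      simp only [nxt, Finset.mem_filter] at hc
      omega
    · intro t ht s hs hts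
      have h := hf t ht
      have h' := hf s hs
      rw [← hts] at h'
      exact rk_inj (hsub ht) (hsub hs) (h.2.2.1.symm.trans h'.2.2.1) (by omega)
  rw [Finset.card_sdiff_of_subset hsub] at h1
  have := Finset.card_le_card hsub
  omega

theorem rk_congr {T T' : Finset ℕ} {β β' : ℕ → ℕ} {t : ℕ}
    (h : ∀ s ≤ t, (s ∈ T ↔ s ∈ T') ∧ β s = β' s) : rk T β t = rk T' β' t := by
  unfold rk
  congr 1
  ext s
  simp only [Finset.mem_filter]
  constructor
  · rintro ⟨h1, h2, h3⟩
    exact ⟨(h s h2.le).1.1 h1, h2, by rw [← (h s h2.le).2, ← (h t le_rfl).2, h3]⟩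
  · rintro ⟨h1, h2, h3⟩
    exact ⟨(h s h2.le).1.2 h1, h2, by rw [(h s h2.le).2, (h t le_rfl).2, h3]⟩

theorem par_congr {T T' : Finset ℕ} {β β' : ℕ → ℕ} {t : ℕ}
    (h : ∀ s ≤ t, (s ∈ T ↔ s ∈ T') ∧ β s = β' s) : par T β t = par T' β' t := by
  have hr : ∀ s ≤ t, rk T β s = rk T' β' s := fun s hs =>
    rk_congr (fun x hx => h x (hx.trans hs))
  unfold par
  rw [hr t le_rfl]
  have : (fun s => s < t ∧ s ∈ T ∧ β s = β t ∧ rk T β s + 1 = rk T' β' t)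
      = (fun s => s < t ∧ s ∈ T' ∧ β' s = β' t ∧ rk T' β' s + 1 = rk T' β' t) := by
    funext s
    apply propext
    apply and_congr_right
    intro hs
    rw [(h s hs.le).1, (h s hs.le).2, (h t le_rfl).2, hr s hs.le]
  rw [this]

theorem cell_congr (d : ℕ) : ∀ {T T' : Finset ℕ} {β β' : ℕ → ℕ} {t : ℕ}, t ∈ T →
    (∀ s ≤ t, (s ∈ T ↔ s ∈ T') ∧ β s = β' s) → cell d T β t = cell d T' β' t := by
  induction d with
  | zero =>
    intro T T' β β' t _ h
    simp only [cell]
    rw [rk_congr h, (h t le_rfl).2]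
  | succ d ih =>
    intro T T' β β' t ht h
    simp only [cell]
    rw [← rk_congr h, ← par_congr h, ← (h t le_rfl).2]
    split_ifs with h0
    · rfl
    · have hp := par_spec (T := T) (β := β) ht (by omega)
      rw [ih (T' := nxt T' β') (β' := fun s => β' s / 2) hp.1]
      intro s hs
      have hst := hs.trans hp.2.1
      refine ⟨?_, by simp only [(h s hst).2]⟩
      simp only [nxt, Finset.mem_filter]
      rw [(h s hst).1, rk_congr (fun x hx => h x (hx.trans hst))]

theorem cell_pos (d : ℕ) : ∀ (T : Finset ℕ) (β : ℕ → ℕ) (t : ℕ), t ∈ T →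
    1 ≤ (ofLex (cell d T β t)).2 := by
  induction d with
  | zero => intro T β t _; simp [cell]
  | succ d ih =>
    intro T β t ht
    simp only [cell]
    split_ifs with h0
    · simp
    · have hp := par_spec (T := T) (β := β) ht (by omega)
      have := ih (nxt T β) (fun s => β s / 2) _ hp.1
      simp only [ofLex_toLex]
      omega

theorem cell_inj (d : ℕ) : ∀ (T : Finset ℕ) (β : ℕ → ℕ) (s t : ℕ), s ∈ T → t ∈ T →
    cell d T β s = cell d T β t → s = t := by
  induction d with
  | zero =>
    intro T β s t hs ht h
    simp only [cell, EmbeddingLike.apply_eq_iff_eq, Prod.mk.injEq] at h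
    exact rk_inj (β := β) hs ht (by omega) (by omega)
  | succ d ih =>
    intro T β s t hs ht h
    simp only [cell] at h
    split_ifs at h with h0 h1 h1
    · simp only [EmbeddingLike.apply_eq_iff_eq, Prod.mk.injEq] at h
      exact rk_inj (β := β) hs ht (by omega) (by omega)
    · simp only [EmbeddingLike.apply_eq_iff_eq, Prod.mk.injEq] at h
      omega
    · simp only [EmbeddingLike.apply_eq_iff_eq, Prod.mk.injEq] at h
      omega
    · simp only [EmbeddingLike.apply_eq_iff_eq, Prod.mk.injEq] at h
      have hps := par_spec (T := T) (β := β) hs (by omega)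
      have hpt := par_spec (T := T) (β := β) ht (by omega)
      have h2s := cell_pos d _ (fun s => β s / 2) _ hps.1
      have h2t := cell_pos d _ (fun s => β s / 2) _ hpt.1
      have heq : par T β s = par T β t := by
        apply ih (nxt T β) (fun s => β s / 2) _ _ hps.1 hpt.1
        apply ofLex.injective
        apply Prod.ext <;> omega
      have hm : rk T β s % 2 = rk T β t % 2 := by omega
      apply rk_inj (β := β) hs ht
      · rw [← hps.2.2.1, ← hpt.2.2.1, heq]
      · rw [← hps.2.2.2, ← hpt.2.2.2, heq, hm]

/-- the set of cells -/
def cells (L : ℕ) : ℕ → Finset (ℕ ×ₗ ℕ)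
  | 0 => (Finset.range L ×ˢ Finset.range 2).image (fun p => toLex (2 * p.1 + 1, p.2 + 1))
  | d + 1 => (Finset.range (2 ^ (d + 1) * L) ×ˢ Finset.range 2).image
        (fun p => toLex (2 * p.1 + 1, p.2 + 1)) ∪
      (cells L d ×ˢ Finset.range 2).image
        (fun p => toLex (2 * (ofLex p.1).1, 2 * (ofLex p.1).2 - 1 + p.2))

theorem cells_card (L d : ℕ) : (cells L d).card ≤ 2 * (2 ^ d * L) * (d + 1) := by
  induction d with
  | zero =>
    refine Finset.card_image_le.trans ?_
    simp
    omega
  | succ d ih =>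
    refine (Finset.card_union_le _ _).trans ?_
    refine (Nat.add_le_add Finset.card_image_le Finset.card_image_le).trans ?_
    simp only [Finset.card_product, Finset.card_range]
    rw [pow_succ]
    nlinarith

theorem cells_le (L d : ℕ) : ∀ c ∈ cells L d, (ofLex c).1 ≤ 2 * (2 ^ d * L) := by
  induction d with
  | zero =>
    intro c hc
    simp only [cells, Finset.mem_image, Finset.mem_product, Finset.mem_range] at hc
    obtain ⟨p, hp, rfl⟩ := hc
    simp only [ofLex_toLex]
    omega
  | succ d ih =>
    intro c hc
    simp only [cells, Finset.mem_union, Finset.mem_image, Finset.mem_product,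
      Finset.mem_range] at hc
    rcases hc with ⟨p, hp, rfl⟩ | ⟨p, hp, rfl⟩
    · simp only [ofLex_toLex]
      omega
    · have := ih _ hp.1
      simp only [ofLex_toLex]
      rw [pow_succ]
      nlinarith

theorem cell_mem (L d : ℕ) : ∀ (T : Finset ℕ) (β : ℕ → ℕ) (t : ℕ), t ∈ T → T.card ≤ 2 ^ d →
    (∀ s, β s < 2 ^ d * L) → cell d T β t ∈ cells L d := by
  induction d with
  | zero =>
    intro T β t ht hT hb
    simp only [cells, cell, Finset.mem_image, Finset.mem_product, Finset.mem_range]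
    refine ⟨(β t, rk T β t), ⟨by simpa using hb t, ?_⟩, rfl⟩
    have : rk T β t ≤ T.card := Finset.card_filter_le _ _
    simp at hT ⊢
    omega
  | succ d ih =>
    intro T β t ht hT hb
    simp only [cells, cell, Finset.mem_union, Finset.mem_image, Finset.mem_product,
      Finset.mem_range]
    split_ifs with h0
    · exact Or.inl ⟨(β t, rk T β t), ⟨hb t, h0⟩, rfl⟩
    · right
      have hp := par_spec (T := T) (β := β) ht (by omega)
      have hc := card_nxt T β
      refine ⟨(cell d (nxt T β) (fun s => β s / 2) (par T β t), rk T β t % 2), ⟨?_, ?_⟩, rfl⟩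
      · apply ih _ _ _ hp.1
        · rw [pow_succ] at hT
          omega
        · intro s
          have := hb s
          rw [pow_succ] at this
          have h2 : β s < 2 * (2 ^ d * L) := by nlinarith
          omega
      · exact Nat.mod_lt _ (by norm_num)

def piMap (x : ℕ ×ₗ ℕ) : ℕ ×ₗ ℕ :=
  if (ofLex x).1 % 2 = 0 then toLex ((ofLex x).1 / 2, ((ofLex x).2 + 1) / 2)
  else toLex (((ofLex x).1 + 1) / 2, 0)

theorem piMap_mono : Monotone piMap := by
  intro x y h
  rw [Prod.Lex.le_iff] at h
  unfold piMap
  split_ifs <;> rw [Prod.Lex.toLex_le_toLex] <;> simp only <;> omega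

theorem main_H (d : ℕ) : ∀ (T : Finset ℕ) (β : ℕ → ℕ), T.card ≤ 2 ^ d →
    ∃ H G : ℕ ×ₗ ℕ → ℝ, (∀ x, 0 ≤ G x ∧ G x ≤ d * 2 ^ d) ∧
      (∀ a : ℕ, H (toLex (a, 0)) = 0) ∧
      (∀ x y, x ≤ y → |H x - H y| ≤ G y - G x) ∧
      ∀ t ∈ T, (2 * β t + 1 : ℝ) = (ofLex (cell d T β t)).1 + H (cell d T β t) := by
  induction d with
  | zero =>
    intro T β hT
    refine ⟨fun _ => 0, fun _ => 0, by simp, by simp, by simp, ?_⟩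
    intro t ht
    simp [cell]
  | succ d ih =>
    intro T β hT
    have hc := card_nxt T β
    have hc' : (nxt T β).card ≤ 2 ^ d := by
      rw [pow_succ] at hT
      omega
    obtain ⟨H, G, hG, hH0, hHG, hcell⟩ := ih (nxt T β) (fun s => β s / 2) hc'
    set c' := cell d (nxt T β) (fun s => β s / 2) with hcdef
    let e : ℕ → ℝ := fun s => 2 * ((β s % 2 : ℕ) : ℝ) - 1
    have he : ∀ s, |e s| ≤ 1 := by
      intro s
      simp only [e]
      rcases Nat.mod_two_eq_zero_or_one (β s) with h | h <;> rw [h] <;> norm_num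
    let ε : ℕ ×ₗ ℕ → ℝ := fun x => ∑ s ∈ nxt T β, if x = c' s then e s else 0
    let E : ℕ ×ₗ ℕ → ℝ := fun x => ∑ s ∈ nxt T β,
      ((if c' s ≤ x then (1 : ℝ) else 0) + (if c' s < x then 1 else 0))
    have hE : ∀ x, 0 ≤ E x ∧ E x ≤ 2 * 2 ^ d := by
      intro x
      constructor
      · apply Finset.sum_nonneg
        intro s _
        split_ifs <;> norm_num
      · have : E x ≤ ∑ s ∈ nxt T β, (2 : ℝ) := by
          apply Finset.sum_le_sum
          intro s _
          split_ifs <;> norm_num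
        rw [Finset.sum_const, nsmul_eq_mul] at this
        have h3 : ((nxt T β).card : ℝ) ≤ 2 ^ d := by exact_mod_cast hc'
        linarith
    have hεE : ∀ x y, x ≤ y → |ε x - ε y| ≤ E y - E x := by
      intro x y hxy
      simp only [ε, E]
      rw [← Finset.sum_sub_distrib, ← Finset.sum_sub_distrib]
      refine (Finset.abs_sum_le_sum_abs _ _).trans ?_
      apply Finset.sum_le_sum
      intro s _
      have h1 := he s
      rcases eq_or_lt_of_le hxy with h | h
      · subst h
        simp
      · rcases lt_trichotomy x (c' s) with hx | hx | hx
        · rcases lt_trichotomy y (c' s) with hy | hy | hy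
          · simp [hx.ne, hy.ne, hx.not_ge, hy.not_ge, hx.not_gt, hy.not_gt]
          · subst hy
            simp [hx.ne, hx.not_ge, hx.not_gt]
            exact h1
          · simp [hx.ne, hx.not_ge, hx.not_gt, hy, hy.le, hy.ne']
        · subst hx
          simp [h, h.le, h.ne']
          exact h1
        · have hy := hx.trans h
          simp [hx, hx.le, hx.ne', hy, hy.le, hy.ne']
    have hε0 : ∀ a : ℕ, ε (toLex (a, 0)) = 0 := by
      intro a
      apply Finset.sum_eq_zero
      intro s hs
      rw [if_neg]
      intro h
      have := cell_pos d _ (fun s => β s / 2) _ hs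
      rw [← hcdef, ← h] at this
      simp at this
    have hεs : ∀ s ∈ nxt T β, ε (c' s) = e s := by
      intro s hs
      simp only [ε]
      rw [Finset.sum_eq_single s]
      · simp
      · intro b hb hbs
        rw [if_neg]
        intro h
        exact hbs (cell_inj d _ _ _ _ hb hs h.symm)
      · intro h
        exact absurd hs h
    refine ⟨fun x => 2 * H (piMap x) + ε (piMap x), fun x => 2 * G (piMap x) + E (piMap x),
      ?_, ?_, ?_, ?_⟩
    · intro x
      have h1 := hG (piMap x)
      have h2 := hE (piMap x)
      push_cast
      rw [pow_succ]
      constructor <;> nlinarith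
    · intro a
      have : ∃ b : ℕ, piMap (toLex (a, 0)) = toLex (b, 0) := by
        unfold piMap
        split_ifs
        · exact ⟨a / 2, by simp⟩
        · exact ⟨(a + 1) / 2, by simp⟩
      obtain ⟨b, hb⟩ := this
      simp only [hb, hH0, hε0]
      norm_num
    · intro x y hxy
      have h1 := hHG _ _ (piMap_mono hxy)
      have h2 := hεE _ _ (piMap_mono hxy)
      simp only
      rw [abs_le] at *
      constructor <;> linarith [h1.1, h1.2, h2.1, h2.2]
    · intro t ht
      simp only [cell]
      split_ifs with h0
      · have : piMap (toLex (2 * β t + 1, rk T β t + 1)) = toLex (β t + 1, 0) := by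
          unfold piMap
          rw [if_neg (by simp only [ofLex_toLex]; omega)]
          simp only [ofLex_toLex]
          congr 2
          omega
        rw [this, hH0, hε0]
        simp
      · have hp := par_spec (T := T) (β := β) ht (by omega)
        rw [← hcdef]
        have hq : 1 ≤ (ofLex (c' (par T β t))).2 := cell_pos d _ _ _ hp.1
        have : piMap (toLex (2 * (ofLex (c' (par T β t))).1,
            2 * (ofLex (c' (par T β t))).2 - 1 + rk T β t % 2)) = c' (par T β t) := by
          unfold piMap
          rw [if_pos (by simp only [ofLex_toLex]; omega)]
          simp only [ofLex_toLex]
          apply ofLex.injective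
          apply Prod.ext
          · simp
          · simp only [ofLex_toLex]
            omega
        rw [this, hεs _ hp.1]
        have h5 := hcell _ hp.1
        simp only [hp.2.2.1] at h5
        simp only [e, hp.2.2.1, ofLex_toLex]
        have h6 : (β t : ℝ) = 2 * ((β t / 2 : ℕ) : ℝ) + ((β t % 2 : ℕ) : ℝ) := by
          exact_mod_cast (Nat.div_add_mod (β t) 2).symm
        push_cast at *
        linarith

theorem configCost_le_s2 {N : ℕ} (g : Fin N → Option ℝ) (Φ : ℕ → ℝ) (hΦ : Monotone Φ)
    (h : ∀ i j : Fin N, (g i).isSome = true → (g j).isSome = true → i < j →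
      |(g i).getD 0 - (g j).getD 0| ≤ Φ j - Φ i) :
    configCost g ≤ Φ N - Φ 0 := by
  classical
  have h1 : configCost g ≤ ∑ i : Fin N, ∑ j : Fin N, ∑ k ∈ Finset.range N,
      if (g i).isSome = true ∧ (g j).isSome = true ∧ i < j ∧
        (∀ k : Fin N, i < k → k < j → g k = none) ∧ i.1 ≤ k ∧ k < j.1 then
        Φ (k + 1) - Φ k else 0 := by
    unfold configCost
    apply Finset.sum_le_sum
    intro i _
    apply Finset.sum_le_sum
    intro j _
    split_ifs with hc
    · refine (h i j hc.1 hc.2.1 hc.2.2.1).trans ?_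
      simp only [hc.1, hc.2.1, hc.2.2.1, true_and]
      have h3 : (∀ k : Fin N, i < k → k < j → g k = none) := hc.2.2.2
      rw [← Finset.sum_filter]
      have h4 : (Finset.range N).filter (fun k => (∀ k : Fin N, i < k → k < j → g k = none) ∧
          i.1 ≤ k ∧ k < j.1) = Finset.Ico i.1 j.1 := by
        ext k
        simp only [Finset.mem_filter, Finset.mem_range, Finset.mem_Ico]
        have := j.2
        constructor
        · rintro ⟨_, _, h5⟩
          exact h5
        · intro h5
          exact ⟨by omega, h3, h5⟩
      rw [h4, Finset.sum_Ico_sub Φ (le_of_lt hc.2.2.1)]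
    · apply Finset.sum_nonneg
      intro k _
      split_ifs
      · linarith [hΦ (Nat.le_succ k)]
      · exact le_rfl
  refine h1.trans ?_
  rw [← Finset.sum_range_sub Φ N]
  have h2 : ∀ i : Fin N, (∑ j : Fin N, ∑ k ∈ Finset.range N,
      if (g i).isSome = true ∧ (g j).isSome = true ∧ i < j ∧
        (∀ k : Fin N, i < k → k < j → g k = none) ∧ i.1 ≤ k ∧ k < j.1 then
        Φ (k + 1) - Φ k else 0) = ∑ k ∈ Finset.range N, ∑ j : Fin N,
      if (g i).isSome = true ∧ (g j).isSome = true ∧ i < j ∧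
        (∀ k : Fin N, i < k → k < j → g k = none) ∧ i.1 ≤ k ∧ k < j.1 then
        Φ (k + 1) - Φ k else 0 := fun i => Finset.sum_comm
  simp only [h2]
  rw [Finset.sum_comm]
  apply Finset.sum_le_sum
  intro k _
  rw [← Finset.sum_product', ← Finset.sum_filter, Finset.sum_const, nsmul_eq_mul]
  have hcard : (((Finset.univ : Finset (Fin N)) ×ˢ (Finset.univ : Finset (Fin N))).filter
      (fun p : Fin N × Fin N => (g p.1).isSome = true ∧ (g p.2).isSome = true ∧ p.1 < p.2 ∧
        (∀ k : Fin N, p.1 < k → k < p.2 → g k = none) ∧ p.1.1 ≤ k ∧ k < p.2.1)).card ≤ 1 := by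
    rw [Finset.card_le_one]
    rintro ⟨i, j⟩ hp ⟨i', j'⟩ hp'
    simp only [Finset.mem_filter, Finset.mem_product, Finset.mem_univ, true_and] at hp hp'
    obtain ⟨a1, a2, a3, a4, a5, a6⟩ := hp
    obtain ⟨b1, b2, b3, b4, b5, b6⟩ := hp'
    have e1 : i = i' := by
      rcases lt_trichotomy i i' with hh | hh | hh
      · have := a4 i' hh (Fin.lt_def.2 (by omega))
        simp [this] at b1
      · exact hh
      · have := b4 i hh (Fin.lt_def.2 (by omega))
        simp [this] at a1
    have e2 : j = j' := by
      rcases lt_trichotomy j j' with hh | hh | hh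
      · have := b4 j (Fin.lt_def.2 (by omega)) hh
        simp [this] at a2
      · exact hh
      · have := a4 j' (Fin.lt_def.2 (by omega)) hh
        simp [this] at b2
    rw [e1, e2]
  have hpos : 0 ≤ Φ (k + 1) - Φ k := by linarith [hΦ (Nat.le_succ k)]
  have hc1 : ((((Finset.univ : Finset (Fin N)) ×ˢ (Finset.univ : Finset (Fin N))).filter
      (fun p : Fin N × Fin N => (g p.1).isSome = true ∧ (g p.2).isSome = true ∧ p.1 < p.2 ∧
        (∀ k : Fin N, p.1 < k → k < p.2 → g k = none) ∧ p.1.1 ≤ k ∧ k < p.2.1)).card : ℝ) ≤ 1 := by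
    exact_mod_cast hcard
  calc _ ≤ 1 * (Φ (k + 1) - Φ k) := mul_le_mul_of_nonneg_right hc1 hpos
    _ = _ := one_mul _

theorem withSentinels_cases {n m : ℕ} (a : Fin n → ℝ) (pl : Fin n → Fin m) (i : Fin (m + 2))
    (h : (withSentinels a pl i).isSome = true) :
    (i.1 = 0 ∧ (withSentinels a pl i).getD 0 = 0) ∨
    (i.1 = m + 1 ∧ (withSentinels a pl i).getD 0 = 1) ∨
    ∃ t, (pl t).1 + 1 = i.1 ∧ (withSentinels a pl i).getD 0 = a t := by
  unfold withSentinels at *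
  split_ifs at h ⊢ with h1 h2 h3
  · exact Or.inl ⟨h1, rfl⟩
  · exact Or.inr (Or.inl ⟨h2, rfl⟩)
  · exact Or.inr (Or.inr ⟨_, h3.choose_spec, rfl⟩)
  · simp at h

theorem clog_facts (n : ℕ) (hn : 2 ≤ n) : 1 ≤ Nat.clog 2 n ∧ n ≤ 2 ^ (Nat.clog 2 n) ∧
    2 ^ (Nat.clog 2 n) ≤ 2 * n ∧ (Nat.clog 2 n : ℝ) ≤ 2 * Real.logb 2 n := by
  have h1 : 1 ≤ Nat.clog 2 n := Nat.clog_pos (by norm_num) hn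
  have h2 : 2 ^ (Nat.clog 2 n - 1) < n := Nat.pow_pred_clog_lt_self (by norm_num) (by omega)
  obtain ⟨k, hk⟩ : ∃ k, Nat.clog 2 n = k + 1 := ⟨_, (Nat.sub_add_cancel h1).symm⟩
  refine ⟨h1, Nat.le_pow_clog (by norm_num) n, ?_, ?_⟩
  · rw [hk] at h2 ⊢
    rw [pow_succ]
    simp at h2
    omega
  · rw [hk] at h2 ⊢
    simp at h2
    have h3 : (k : ℝ) ≤ Real.logb 2 n := by
      rw [Real.le_logb_iff_rpow_le (by norm_num) (by positivity), Real.rpow_natCast]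
      exact_mod_cast h2.le
    have h4 : (1 : ℝ) ≤ Real.logb 2 n := by
      rw [Real.le_logb_iff_rpow_le (by norm_num) (by positivity), Real.rpow_one]
      exact_mod_cast hn
    push_cast
    linarith

theorem bucket_spec (M : ℕ) (hM : 1 ≤ M) (x : ℝ) (hx : x ∈ Set.Icc (0 : ℝ) 1) :
    |x - (2 * (min ⌊x * M⌋₊ (M - 1) : ℕ) + 1) / (2 * M)| ≤ 1 / (2 * M) := by
  have hMr : (1 : ℝ) ≤ M := by exact_mod_cast hM
  have hMp : (0 : ℝ) < 2 * M := by linarith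
  have h0 : 0 ≤ x * M := mul_nonneg hx.1 (by linarith)
  have hxM : x * M ≤ M := by nlinarith [hx.2]
  have key : ((min ⌊x * M⌋₊ (M - 1) : ℕ) : ℝ) ≤ x * M ∧
      x * M ≤ ((min ⌊x * M⌋₊ (M - 1) : ℕ) : ℝ) + 1 := by
    rcases le_total ⌊x * M⌋₊ (M - 1) with h | h
    · rw [min_eq_left h]
      exact ⟨Nat.floor_le h0, (Nat.lt_floor_add_one _).le⟩
    · rw [min_eq_right h]
      constructor
      · exact (Nat.cast_le.2 h).trans (Nat.floor_le h0)
      · rw [Nat.cast_sub hM]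
        push_cast
        linarith
  have : x - (2 * (min ⌊x * M⌋₊ (M - 1) : ℕ) + 1) / (2 * M)
      = (2 * (x * M) - (2 * (min ⌊x * M⌋₊ (M - 1) : ℕ) + 1)) / (2 * M) := by
    field_simp
  rw [this, abs_div, abs_of_pos hMp]
  apply div_le_div_of_nonneg_right _ hMp.le
  rw [abs_le]
  constructor <;> linarith [key.1, key.2]

theorem statement2 :
    ∃ C : ℝ, 0 < C ∧
      ∀ n : ℕ, 2 ≤ n →
        ∃ m : ℕ, (m : ℝ) ≤ C * n * (Real.logb 2 n) ^ 2 ∧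
          ∃ strat : List ℝ → Fin m,
            ∀ a : Fin n → ℝ, (∀ t, a t ∈ Set.Icc (0 : ℝ) 1) →
              Function.Injective (place strat a) ∧
              configCost (withSentinels a (place strat a)) ≤ C := by
  refine ⟨32, by norm_num, fun n hn => ?_⟩
  obtain ⟨hd1, hnd, hdn, hdlog⟩ := clog_facts n hn
  generalize Nat.clog 2 n = d at hd1 hnd hdn hdlog
  obtain ⟨M, hM⟩ : ∃ M : ℕ, M = 2 ^ d * d := ⟨_, rfl⟩
  have hM1 : 1 ≤ M := by
    rw [hM]
    exact Nat.mul_pos (by positivity) hd1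
  let S := cells d d
  have hcard : (Finset.range n).card ≤ 2 ^ d := by simpa using hnd
  let bl : List ℝ → ℕ → ℕ := fun l s => min ⌊(l.getD s 0) * M⌋₊ (M - 1)
  have hbl : ∀ l s, bl l s < 2 ^ d * d := by
    intro l s
    have : bl l s ≤ M - 1 := min_le_right _ _
    omega
  have hmem : ∀ l, ∀ t < n, cell d (Finset.range n) (bl l) t ∈ S := fun l t ht =>
    cell_mem d d _ _ _ (Finset.mem_range.2 ht) hcard (hbl l)
  let iso := S.orderIsoOfFin rfl
  refine ⟨S.card, ?_, ?_⟩
  · have h1 : (S.card : ℝ) ≤ 2 * (2 ^ d * d) * (d + 1) := by exact_mod_cast cells_card d d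
    have h2 : (2 : ℝ) ^ d ≤ 2 * n := by exact_mod_cast hdn
    have h3 : (1 : ℝ) ≤ d := by exact_mod_cast hd1
    have hn0 : (0 : ℝ) ≤ n := by positivity
    calc (S.card : ℝ) ≤ 2 * (2 ^ d * d) * (d + 1) := h1
      _ ≤ 2 * ((2 * n) * d) * (d + d) := by gcongr
      _ = 8 * n * (d : ℝ) ^ 2 := by ring
      _ ≤ 8 * n * (2 * Real.logb 2 n) ^ 2 := by gcongr
      _ = 32 * n * (Real.logb 2 n) ^ 2 := by ring
  let strat : List ℝ → Fin S.card := fun l =>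
    if h : cell d (Finset.range n) (bl l) (l.length - 1) ∈ S then iso.symm ⟨_, h⟩
    else iso.symm ⟨_, hmem [] 0 (by omega)⟩
  refine ⟨strat, fun a ha => ?_⟩
  let β := bl (List.ofFn a)
  let key := cell d (Finset.range n) β
  have hpl : ∀ t : Fin n, (iso (place strat a t)).1 = key t := by
    intro t
    have hlen : ((List.ofFn a).take (t.1 + 1)).length - 1 = t.1 := by
      simp only [List.length_take, List.length_ofFn]
      have := t.2
      omega
    have heq : cell d (Finset.range n) (bl ((List.ofFn a).take (t.1 + 1))) t.1 = key t.1 := by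
      apply cell_congr d (Finset.mem_range.2 t.2)
      intro s hs
      refine ⟨Iff.rfl, ?_⟩
      simp only [β, bl]
      have : ((List.ofFn a).take (t.1 + 1)).getD s 0 = (List.ofFn a).getD s 0 := by
        rw [List.getD_eq_getElem?_getD, List.getD_eq_getElem?_getD,
          List.getElem?_take_of_lt (by omega)]
      rw [this]
    have hm := hmem ((List.ofFn a).take (t.1 + 1)) t.1 t.2
    simp only [place, strat, hlen]
    rw [dif_pos hm, OrderIso.apply_symm_apply]
    exact heq
  have hkinj : ∀ s t : Fin n, key s = key t → s = t := fun s t h =>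
    Fin.ext (cell_inj d _ _ _ _ (Finset.mem_range.2 s.2) (Finset.mem_range.2 t.2) h)
  have hinj : Function.Injective (place strat a) := by
    intro s t h
    apply hkinj
    rw [← hpl, ← hpl, h]
  refine ⟨hinj, ?_⟩
  obtain ⟨H, G, hG, -, hHG, hcell⟩ := main_H d (Finset.range n) β hcard
  have hMr : (1 : ℝ) ≤ M := by exact_mod_cast hM1
  have hMp : (0 : ℝ) < 2 * M := by linarith
  let E : ℕ ×ₗ ℕ → ℝ := fun x => ∑ s : Fin n, if key s ≤ x then (1 : ℝ) else 0
  have hE0 : ∀ x, 0 ≤ E x := fun x => Finset.sum_nonneg (fun s _ => by split_ifs <;> norm_num)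
  have hE1 : ∀ x, E x ≤ M := by
    intro x
    have h1 : E x ≤ ∑ s : Fin n, (1 : ℝ) :=
      Finset.sum_le_sum (fun s _ => by split_ifs <;> norm_num)
    simp at h1
    have h2 : n ≤ M := by
      rw [hM]
      nlinarith
    have h3 : (n : ℝ) ≤ M := by exact_mod_cast h2
    linarith
  have hEmono : ∀ x y, x ≤ y → E x ≤ E y := by
    intro x y hxy
    apply Finset.sum_le_sum
    intro s _
    by_cases h : key s ≤ x
    · rw [if_pos h, if_pos (h.trans hxy)]
    · rw [if_neg h]
      split_ifs <;> norm_num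
  have hEstep : ∀ x, ∀ t : Fin n, x < key t → E x + 1 ≤ E (key t) := by
    intro x t hx
    have h1 : ∑ s : Fin n, ((if key s ≤ x then (1 : ℝ) else 0) + if s = t then 1 else 0)
        ≤ E (key t) := by
      apply Finset.sum_le_sum
      intro s _
      by_cases hst : s = t
      · subst hst
        simp [hx.not_ge]
      · by_cases h : key s ≤ x
        · simp [h, hst, h.trans hx.le]
        · simp only [h, hst, if_false]
          split_ifs <;> norm_num
    rw [Finset.sum_add_distrib, Finset.sum_ite_eq' Finset.univ t,
      if_pos (Finset.mem_univ t)] at h1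
    exact h1
  let F : ℕ ×ₗ ℕ → ℝ := fun x => (((ofLex x).1 : ℝ) + G x + 2 * E x) / (2 * M)
  have hGmono : ∀ x y, x ≤ y → G x ≤ G y := fun x y hxy => by
    linarith [hHG x y hxy, abs_nonneg (H x - H y)]
  have hamono : ∀ x y : ℕ ×ₗ ℕ, x ≤ y → ((ofLex x).1 : ℝ) ≤ (ofLex y).1 := by
    intro x y hxy
    rw [Prod.Lex.le_iff] at hxy
    have : (ofLex x).1 ≤ (ofLex y).1 := by omega
    exact_mod_cast this
  have hFmono : ∀ x y, x ≤ y → F x ≤ F y := by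
    intro x y hxy
    apply div_le_div_of_nonneg_right _ hMp.le
    linarith [hGmono x y hxy, hamono x y hxy, hEmono x y hxy]
  have hF0 : ∀ x, 0 ≤ F x := by
    intro x
    apply div_nonneg _ hMp.le
    have := (hG x).1
    have := hE0 x
    positivity
  have hF1 : ∀ x ∈ S, F x ≤ 3 := by
    intro x hx
    have h1 : ((ofLex x).1 : ℝ) ≤ 2 * M := by
      rw [hM]
      exact_mod_cast cells_le d d x hx
    have h2 : G x ≤ M := by
      rw [hM]
      push_cast
      linarith [(hG x).2]
    have h3 := hE1 x
    simp only [F]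
    rw [div_le_iff₀ hMp]
    linarith
  have hdist : ∀ s t : Fin n, key s < key t → |a s - a t| ≤ F (key t) - F (key s) := by
    intro s t hst
    have hb : ∀ t : Fin n, |a t - (2 * (β t.1 : ℝ) + 1) / (2 * M)| ≤ 1 / (2 * M) := by
      intro t
      have h1 := bucket_spec M hM1 (a t) (ha t)
      have h2 : β t.1 = min ⌊a t * M⌋₊ (M - 1) := by
        simp [β, bl]
      rw [h2]
      exact h1
    have h1 := hb s
    have h2 := hb t
    have h3 := hHG _ _ hst.le
    have h4 := hEstep _ _ hst
    have h5 := hamono _ _ hst.le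
    have h6 := hcell s.1 (Finset.mem_range.2 s.2)
    have h7 := hcell t.1 (Finset.mem_range.2 t.2)
    change _ = ((ofLex (key s)).1 : ℝ) + H (key s) at h6
    change _ = ((ofLex (key t)).1 : ℝ) + H (key t) at h7
    have h8 : |(2 * (β s.1 : ℝ) + 1) / (2 * M) - (2 * (β t.1 : ℝ) + 1) / (2 * M)| ≤
        (((ofLex (key t)).1 : ℝ) - (ofLex (key s)).1 + (G (key t) - G (key s))) / (2 * M) := by
      rw [← sub_div, abs_div, abs_of_pos hMp]
      apply div_le_div_of_nonneg_right _ hMp.le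
      rw [h6, h7]
      rw [abs_le] at h3 ⊢
      constructor <;> linarith [h3.1, h3.2]
    have h9 : F (key t) - F (key s) =
        (((ofLex (key t)).1 : ℝ) - (ofLex (key s)).1 + (G (key t) - G (key s))) / (2 * M)
          + 2 * (E (key t) - E (key s)) / (2 * M) := by
      simp only [F]
      ring
    have h10 : 2 * (1 / (2 * (M : ℝ))) ≤ 2 * (E (key t) - E (key s)) / (2 * M) := by
      rw [mul_one_div]
      apply div_le_div_of_nonneg_right _ hMp.le
      linarith
    rw [h9]
    rw [abs_le] at *
    constructor <;> linarith [h1.1, h1.2, h2.1, h2.2, h8.1, h8.2]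
  let Φ : ℕ → ℝ := fun p => if p = 0 then -1 else
    if h : p - 1 < S.card then F (iso ⟨p - 1, h⟩).1 else 4
  have hΦmono : Monotone Φ := by
    intro p q hpq
    simp only [Φ]
    split_ifs with h1 h2 h3 h4 h5 h6 h7
    · exact le_rfl
    · linarith [hF0 (iso ⟨q - 1, h3⟩).1]
    · norm_num
    · omega
    · apply hFmono
      apply Subtype.coe_le_coe.2
      apply iso.monotone
      exact Fin.mk_le_mk.2 (by omega)
    · linarith [hF1 _ (iso ⟨p - 1, h4⟩).2]
    · omega
    · omega
    · exact le_rfl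
  have hΦ0 : Φ 0 = -1 := by simp [Φ]
  have hΦ1 : Φ (S.card + 1) = 4 := by simp [Φ]
  have hΦ2 : Φ (S.card + 2) = 4 := by simp [Φ]
  have hΦt : ∀ t, Φ ((place strat a t).1 + 1) = F (key t) := by
    intro t
    rw [← hpl]
    simp [Φ]
  have hcost := configCost_le_s2 (withSentinels a (place strat a)) Φ hΦmono ?_
  · rw [hΦ0, hΦ2] at hcost
    linarith
  · intro i j hi hj hij
    have hij' : i.1 < j.1 := hij
    have hjlt := j.2
    rcases withSentinels_cases _ _ i hi with ⟨hi1, hi2⟩ | ⟨hi1, hi2⟩ | ⟨s, hi1, hi2⟩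
    · rcases withSentinels_cases _ _ j hj with ⟨hj1, hj2⟩ | ⟨hj1, hj2⟩ | ⟨t, hj1, hj2⟩
      · omega
      · rw [hi2, hj2, hi1, hj1, hΦ0, hΦ1]
        norm_num
      · rw [hi2, hj2, hi1, ← hj1, hΦ0, hΦt, zero_sub, abs_neg, abs_of_nonneg (ha t).1]
        linarith [(ha t).2, hF0 (key t)]
    · omega
    · have hFs : F (key s) ≤ 3 := by
        rw [← hpl]
        exact hF1 _ (iso _).2
      rcases withSentinels_cases _ _ j hj with ⟨hj1, hj2⟩ | ⟨hj1, hj2⟩ | ⟨t, hj1, hj2⟩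
      · omega
      · rw [hi2, hj2, ← hi1, hj1, hΦ1, hΦt, abs_sub_comm, abs_of_nonneg (by linarith [(ha s).2])]
        linarith [(ha s).1]
      · rw [hi2, hj2, ← hi1, ← hj1, hΦt, hΦt]
        apply hdist
        rw [← hpl, ← hpl]
        apply Subtype.coe_lt_coe.2
        apply iso.strictMono
        exact Fin.lt_def.2 (by omega)
end
end
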